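/- arXiv:2506.08831 — 5 statements merged into one kernel-verified Lean document; each statement's English description precedes it below -/
import Mathlib

section
/- Let n ≥ 1 be an integer and let k, ℓ, δ, ε be real numbers with 0 ≤ k < n, 0 ≤ ℓ < n, δ > 0, ε > 0, k + ℓ + δ ≥ n and k + ℓ ≠ n. Then for every real p with max{0, k+ℓ−n} ≤ p ≤ min{k, ℓ, k+ℓ+δ−n} there is a constant C (depending only on n, k, ℓ, δ, ε, p) such that for all x, y ∈ ℝⁿ with x ≠ y: ∫_{ℝⁿ} ⟨z⟩^{−δ−ε} |z − x|^{−k} |y − z|^{−ℓ} dz ≤ C·|x − y|^{−p}. -/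
open MeasureTheory

/-- Radial model function. -/
noncomputable def radF (a b t : ℝ) : ℝ := t ^ (-a) * (max 1 t) ^ (-b)

lemma radF_nonneg (a b t : ℝ) (ht : 0 ≤ t) : 0 ≤ radF a b t := by
  unfold radF
  have : (0 : ℝ) ≤ max 1 t := le_trans zero_le_one (le_max_left _ _)
  positivity

lemma radF_integrable (n : ℕ) (hn : 1 ≤ n) (a b : ℝ) (ha : a < n) (hab : (n : ℝ) < a + b) :
    Integrable (fun u : EuclideanSpace ℝ (Fin n) => radF a b ‖u‖) := by
  haveI : Nonempty (Fin n) := ⟨⟨0, hn⟩⟩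
  haveI : Nontrivial (EuclideanSpace ℝ (Fin n)) := inferInstance
  rw [integrable_fun_norm_addHaar volume (f := radF a b)]
  rw [finrank_euclideanSpace, Fintype.card_fin]
  have hpow : ∀ y : ℝ, 0 < y → y ^ (n - 1) = y ^ ((n : ℝ) - 1) := by
    intro y hy
    rw [← Real.rpow_natCast, Nat.cast_sub hn, Nat.cast_one]
  rw [← Set.Ioc_union_Ioi_eq_Ioi (zero_le_one' ℝ)]
  apply IntegrableOn.union
  · have h : IntegrableOn (fun y : ℝ => y ^ ((n : ℝ) - 1 - a)) (Set.Ioc 0 1) := by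
      have := intervalIntegral.intervalIntegrable_rpow' (a := 0) (b := 1)
        (r := (n : ℝ) - 1 - a) (by linarith)
      rwa [intervalIntegrable_iff_integrableOn_Ioc_of_le zero_le_one] at this
    refine h.congr_fun ?_ measurableSet_Ioc
    intro y hy
    simp only [smul_eq_mul, radF]
    rw [max_eq_left hy.2, Real.one_rpow, mul_one, hpow y hy.1, ← Real.rpow_add hy.1]
    congr 1
  · have h := integrableOn_Ioi_rpow_of_lt (a := (n : ℝ) - 1 - a - b) (c := 1)
      (by linarith) one_pos
    refine h.congr_fun ?_ measurableSet_Ioi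
    intro y hy
    have hy1 : (1 : ℝ) < y := hy
    have hy0 : (0 : ℝ) < y := by linarith
    simp only [smul_eq_mul, radF]
    rw [max_eq_right hy1.le, hpow y hy0, ← Real.rpow_add hy0, ← Real.rpow_add hy0]
    congr 1
    ring

lemma lintegral_le_of_dom {n : ℕ} (f g : EuclideanSpace ℝ (Fin n) → ℝ) (M : ℝ)
    (hg : Integrable g) (hg0 : ∀ z, 0 ≤ g z) (hfg : ∀ᵐ z, f z ≤ g z) (hM : ∫ z, g z ≤ M) :
    ∫⁻ z, ENNReal.ofReal (f z) ≤ ENNReal.ofReal M := by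
  calc ∫⁻ z, ENNReal.ofReal (f z) ≤ ∫⁻ z, ENNReal.ofReal (g z) := by
        apply lintegral_mono_ae
        filter_upwards [hfg] with z hz using ENNReal.ofReal_le_ofReal hz
    _ = ENNReal.ofReal (∫ z, g z) :=
        (ofReal_integral_eq_lintegral_ofReal hg (Filter.Eventually.of_forall hg0)).symm
    _ ≤ _ := ENNReal.ofReal_le_ofReal hM

/-- `w ≤ max(1,·)^{-c}`. -/
lemma weight_le (t c : ℝ) (ht : 0 ≤ t) (hc : 0 ≤ c) :
    Real.sqrt (1 + t ^ 2) ^ (-c) ≤ (max 1 t) ^ (-c) := by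
  apply Real.rpow_le_rpow_of_nonpos (lt_of_lt_of_le one_pos (le_max_left _ _)) _ (by linarith)
  apply Real.le_sqrt_of_sq_le
  rcases max_cases 1 t with ⟨h, _⟩ | ⟨h, _⟩ <;> rw [h] <;> nlinarith

lemma weight_mul_le (t A s c : ℝ) (ht : 0 < t) (hA : 0 < A) (hs : 0 ≤ s) (hc : 0 ≤ c) :
    Real.sqrt (1 + t ^ 2) ^ (-c) * A ^ (-s) ≤ radF s c t + radF s c A := by
  have h1 := weight_le t c ht.le hc
  have p1 := radF_nonneg s c t ht.le
  have p2 := radF_nonneg s c A hA.le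
  have q : 0 ≤ (max 1 t) ^ (-c) := Real.rpow_nonneg (le_trans zero_le_one (le_max_left _ _)) _
  rcases le_total t A with h | h
  · have h2 : A ^ (-s) ≤ t ^ (-s) := Real.rpow_le_rpow_of_nonpos ht h (by linarith)
    have := mul_le_mul h1 h2 (Real.rpow_nonneg hA.le _) q
    have e : radF s c t = (max 1 t) ^ (-c) * t ^ (-s) := mul_comm _ _
    linarith
  · have h3 : (max 1 t) ^ (-c) ≤ (max 1 A) ^ (-c) :=
      Real.rpow_le_rpow_of_nonpos (lt_of_lt_of_le one_pos (le_max_left _ _))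
        (max_le_max le_rfl h) (by linarith)
    have := mul_le_mul_of_nonneg_right (h1.trans h3) (Real.rpow_nonneg hA.le (-s))
    have e : radF s c A = (max 1 A) ^ (-c) * A ^ (-s) := mul_comm _ _
    linarith

lemma prod_le_aux (A B d k l p : ℝ) (hA : 0 < A) (hB : 0 < B) (hd : 0 < d) (hAB : A ≤ B)
    (hdAB : d ≤ A + B) (hp0 : 0 ≤ p) (hpl : p ≤ l) :
    A ^ (-k) * B ^ (-l) ≤ d ^ (-p) * 2 ^ p * A ^ (-(k + l - p)) := by
  have h1 : B ^ (-p) ≤ d ^ (-p) * 2 ^ p := by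
    have : B ^ (-p) ≤ (d / 2) ^ (-p) :=
      Real.rpow_le_rpow_of_nonpos (by positivity) (by linarith) (by linarith)
    rwa [Real.div_rpow hd.le zero_le_two, Real.rpow_neg zero_le_two, div_inv_eq_mul] at this
  have h2 : B ^ (p - l) ≤ A ^ (p - l) := Real.rpow_le_rpow_of_nonpos hA hAB (by linarith)
  have e1 : B ^ (-l) = B ^ (-p) * B ^ (p - l) := by
    rw [← Real.rpow_add hB]; congr 1; ring
  have e2 : A ^ (-(k + l - p)) = A ^ (-k) * A ^ (p - l) := by
    rw [← Real.rpow_add hA]; congr 1; ring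
  rw [e1, e2]
  calc A ^ (-k) * (B ^ (-p) * B ^ (p - l))
      ≤ A ^ (-k) * ((d ^ (-p) * 2 ^ p) * A ^ (p - l)) := by gcongr
    _ = _ := by ring

lemma prod_le_aux2 (A B r k l : ℝ) (hA : 0 < A) (hr : 0 < r) (hAB : A ≤ B)
    (hrB : r ≤ B) (hl : 0 ≤ l) :
    A ^ (-k) * B ^ (-l) ≤ r ^ (-(k + l)) * radF k l (r⁻¹ * A) := by
  have hm : max 1 (r⁻¹ * A) = r⁻¹ * max r A := by
    rw [mul_max_of_nonneg _ _ (by positivity), inv_mul_cancel₀ hr.ne']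
  have hm0 : 0 < max r A := lt_max_of_lt_left hr
  have h : B ^ (-l) ≤ (max r A) ^ (-l) :=
    Real.rpow_le_rpow_of_nonpos hm0 (max_le hrB hAB) (by linarith)
  have : r ^ (-(k + l)) * radF k l (r⁻¹ * A) = A ^ (-k) * (max r A) ^ (-l) := by
    unfold radF
    rw [hm, Real.mul_rpow (by positivity) hA.le, Real.mul_rpow (by positivity) hm0.le,
      Real.inv_rpow hr.le, Real.inv_rpow hr.le, neg_add, Real.rpow_add hr]
    have := (Real.rpow_pos_of_pos hr (-k)).ne'
    have := (Real.rpow_pos_of_pos hr (-l)).ne'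
    field_simp
  rw [this]
  gcongr

lemma scaled_integral (n : ℕ) (k l r : ℝ) (hr : 0 < r) (x : EuclideanSpace ℝ (Fin n)) :
    ∫ z : EuclideanSpace ℝ (Fin n), radF k l (r⁻¹ * ‖z - x‖)
      = r ^ n * ∫ u : EuclideanSpace ℝ (Fin n), radF k l ‖u‖ := by
  rw [integral_sub_right_eq_self (fun z : EuclideanSpace ℝ (Fin n) => radF k l (r⁻¹ * ‖z‖)) x]
  have := Measure.integral_comp_inv_smul_of_nonneg
    (volume : Measure (EuclideanSpace ℝ (Fin n))) (fun u => radF k l ‖u‖) hr.le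
  simpa [norm_smul, abs_of_pos hr] using this

lemma scaled_integrable (n : ℕ) (hn : 1 ≤ n) (k l r : ℝ) (hr : 0 < r)
    (hk : k < n) (hkl : (n : ℝ) < k + l) (x : EuclideanSpace ℝ (Fin n)) :
    Integrable (fun z : EuclideanSpace ℝ (Fin n) => radF k l (r⁻¹ * ‖z - x‖)) := by
  have h := ((radF_integrable n hn k l hk hkl).comp_smul (inv_ne_zero hr.ne')).comp_sub_right x
  simpa [norm_smul, abs_of_pos hr] using h

theorem stmt3 (n : ℕ) (hn : 1 ≤ n) (k l δ ε : ℝ)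
    (hk0 : 0 ≤ k) (hkn : k < n) (hl0 : 0 ≤ l) (hln : l < n)
    (hδ : 0 < δ) (hε : 0 < ε) (hsum : (n : ℝ) ≤ k + l + δ) (hne : k + l ≠ (n : ℝ)) :
    ∀ p : ℝ, max 0 (k + l - n) ≤ p → p ≤ min k (min l (k + l + δ - n)) →
      ∃ C : ℝ, 0 < C ∧ ∀ x y : EuclideanSpace ℝ (Fin n), x ≠ y →
        (∫⁻ z, ENNReal.ofReal
            (Real.sqrt (1 + ‖z‖ ^ 2) ^ (-(δ + ε)) * ‖z - x‖ ^ (-k) * ‖y - z‖ ^ (-l)))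
          ≤ ENNReal.ofReal (C * ‖x - y‖ ^ (-p)) := by
  intro p hp1 hp2
  haveI : Nonempty (Fin n) := ⟨⟨0, hn⟩⟩
  haveI : Nontrivial (EuclideanSpace ℝ (Fin n)) := inferInstance
  have hp0 : 0 ≤ p := le_trans (le_max_left _ _) hp1
  have hpn : k + l - n ≤ p := le_trans (le_max_right _ _) hp1
  have hpk : p ≤ k := hp2.trans (min_le_left _ _)
  have hpl : p ≤ l := hp2.trans ((min_le_right _ _).trans (min_le_left _ _))
  have hpδ : p ≤ k + l + δ - n := hp2.trans ((min_le_right _ _).trans (min_le_right _ _))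
  have hae : ∀ a : EuclideanSpace ℝ (Fin n), ∀ᵐ z : EuclideanSpace ℝ (Fin n), z ≠ a := by
    intro a
    exact Measure.ae_ne volume a
  rcases hpn.lt_or_eq with hlt | heq
  · -- non-critical case
    set s := k + l - p with hs
    have hs0 : 0 ≤ s := by linarith
    have hint := radF_integrable n hn s (δ + ε) (by linarith) (by linarith)
    set J := ∫ u : EuclideanSpace ℝ (Fin n), radF s (δ + ε) ‖u‖ with hJ
    have hJ0 : 0 ≤ J := integral_nonneg (fun u => radF_nonneg _ _ _ (norm_nonneg u))
    refine ⟨2 ^ p * (4 * J) + 1, by positivity, ?_⟩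
    intro x y hxy
    have hd : 0 < ‖x - y‖ := norm_pos_iff.2 (sub_ne_zero.2 hxy)
    have hx := hint.comp_sub_right x
    have hy := hint.comp_sub_right y
    have hIx : ∫ z : EuclideanSpace ℝ (Fin n), radF s (δ + ε) ‖z - x‖ = J :=
      integral_sub_right_eq_self (fun z : EuclideanSpace ℝ (Fin n) => radF s (δ + ε) ‖z‖) x
    have hIy : ∫ z : EuclideanSpace ℝ (Fin n), radF s (δ + ε) ‖z - y‖ = J :=
      integral_sub_right_eq_self (fun z : EuclideanSpace ℝ (Fin n) => radF s (δ + ε) ‖z‖) y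
    refine lintegral_le_of_dom _ (fun z => ‖x - y‖ ^ (-p) * 2 ^ p *
      ((radF s (δ + ε) ‖z‖ + radF s (δ + ε) ‖z - x‖) +
        (radF s (δ + ε) ‖z‖ + radF s (δ + ε) ‖z - y‖))) _ ?_ ?_ ?_ ?_
    · exact ((hint.add hx).add (hint.add hy)).const_mul _
    · intro z
      have h1 := radF_nonneg s (δ + ε) _ (norm_nonneg z)
      have h2 := radF_nonneg s (δ + ε) _ (norm_nonneg (z - x))
      have h3 := radF_nonneg s (δ + ε) _ (norm_nonneg (z - y))
      positivity
    · filter_upwards [hae x, hae y, hae 0] with z hzx hzy hz0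
      have hA : 0 < ‖z - x‖ := norm_pos_iff.2 (sub_ne_zero.2 hzx)
      have hB : 0 < ‖z - y‖ := norm_pos_iff.2 (sub_ne_zero.2 hzy)
      have ht : 0 < ‖z‖ := norm_pos_iff.2 hz0
      rw [norm_sub_rev y z]
      have htri : ‖x - y‖ ≤ ‖z - x‖ + ‖z - y‖ := by
        rw [norm_sub_rev z x]; exact norm_sub_le_norm_sub_add_norm_sub x z y
      have h2 := radF_nonneg s (δ + ε) _ (norm_nonneg z)
      have h3 := radF_nonneg s (δ + ε) _ hA.le
      have h4 := radF_nonneg s (δ + ε) _ hB.le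
      have wA := weight_mul_le ‖z‖ ‖z - x‖ s (δ + ε) ht hA hs0 (by linarith)
      have wB := weight_mul_le ‖z‖ ‖z - y‖ s (δ + ε) ht hB hs0 (by linarith)
      set W := Real.sqrt (1 + ‖z‖ ^ 2) ^ (-(δ + ε)) with hW
      have hW0 : 0 ≤ W := by positivity
      have hK : 0 ≤ ‖x - y‖ ^ (-p) * 2 ^ p := by positivity
      rcases le_total ‖z - x‖ ‖z - y‖ with h | h
      · have := prod_le_aux _ _ _ k l p hA hB hd h htri hp0 hpl
        calc _ = W * (‖z - x‖ ^ (-k) * ‖z - y‖ ^ (-l)) := by ring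
          _ ≤ W * (‖x - y‖ ^ (-p) * 2 ^ p * ‖z - x‖ ^ (-s)) := by gcongr
          _ = ‖x - y‖ ^ (-p) * 2 ^ p * (W * ‖z - x‖ ^ (-s)) := by ring
          _ ≤ _ := by
            apply mul_le_mul_of_nonneg_left _ hK
            linarith
      · have := prod_le_aux _ _ _ l k p hB hA hd h (by linarith) hp0 hpk
        rw [add_comm l k] at this
        calc _ = W * (‖z - y‖ ^ (-l) * ‖z - x‖ ^ (-k)) := by ring
          _ ≤ W * (‖x - y‖ ^ (-p) * 2 ^ p * ‖z - y‖ ^ (-s)) := by gcongr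
          _ = ‖x - y‖ ^ (-p) * 2 ^ p * (W * ‖z - y‖ ^ (-s)) := by ring
          _ ≤ _ := by
            apply mul_le_mul_of_nonneg_left _ hK
            linarith
    · have hax : Integrable (fun z : EuclideanSpace ℝ (Fin n) =>
          radF s (δ + ε) ‖z‖ + radF s (δ + ε) ‖z - x‖) := hint.add hx
      have hay : Integrable (fun z : EuclideanSpace ℝ (Fin n) =>
          radF s (δ + ε) ‖z‖ + radF s (δ + ε) ‖z - y‖) := hint.add hy
      rw [integral_const_mul, integral_add hax hay, integral_add hint hx,
        integral_add hint hy, hIx, hIy, ← hJ]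
      have : 0 ≤ ‖x - y‖ ^ (-p) := by positivity
      nlinarith
  · -- critical case
    have hkl : (n : ℝ) < k + l := by
      rcases lt_or_eq_of_le hp0 with h | h
      · linarith
      · exact absurd (by linarith) hne
    set J1 := ∫ u : EuclideanSpace ℝ (Fin n), radF k l ‖u‖ with hJ1
    set J2 := ∫ u : EuclideanSpace ℝ (Fin n), radF l k ‖u‖ with hJ2
    have hJ10 : 0 ≤ J1 := integral_nonneg (fun u => radF_nonneg _ _ _ (norm_nonneg u))
    have hJ20 : 0 ≤ J2 := integral_nonneg (fun u => radF_nonneg _ _ _ (norm_nonneg u))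
    refine ⟨2 ^ p * (J1 + J2) + 1, by positivity, ?_⟩
    intro x y hxy
    have hd : 0 < ‖x - y‖ := norm_pos_iff.2 (sub_ne_zero.2 hxy)
    set r := ‖x - y‖ / 2 with hr
    have hr0 : 0 < r := by positivity
    have hx := scaled_integrable n hn k l r hr0 hkn hkl x
    have hy := scaled_integrable n hn l k r hr0 hln (by linarith) y
    refine lintegral_le_of_dom _ (fun z => r ^ (-(k + l)) *
      (radF k l (r⁻¹ * ‖z - x‖) + radF l k (r⁻¹ * ‖z - y‖))) _ ?_ ?_ ?_ ?_
    · exact (hx.add hy).const_mul _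
    · intro z
      have h2 := radF_nonneg k l (r⁻¹ * ‖z - x‖) (by positivity)
      have h3 := radF_nonneg l k (r⁻¹ * ‖z - y‖) (by positivity)
      positivity
    · filter_upwards [hae x, hae y] with z hzx hzy
      have hA : 0 < ‖z - x‖ := norm_pos_iff.2 (sub_ne_zero.2 hzx)
      have hB : 0 < ‖z - y‖ := norm_pos_iff.2 (sub_ne_zero.2 hzy)
      rw [norm_sub_rev y z]
      have htri : ‖x - y‖ ≤ ‖z - x‖ + ‖z - y‖ := by
        rw [norm_sub_rev z x]; exact norm_sub_le_norm_sub_add_norm_sub x z y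
      have h2 := radF_nonneg k l (r⁻¹ * ‖z - x‖) (by positivity)
      have h3 := radF_nonneg l k (r⁻¹ * ‖z - y‖) (by positivity)
      have hW1 : Real.sqrt (1 + ‖z‖ ^ 2) ^ (-(δ + ε)) ≤ 1 := by
        apply Real.rpow_le_one_of_one_le_of_nonpos _ (by linarith)
        apply Real.le_sqrt_of_sq_le
        nlinarith [sq_nonneg ‖z‖]
      have hP : 0 ≤ ‖z - x‖ ^ (-k) * ‖z - y‖ ^ (-l) := by positivity
      rw [mul_assoc]
      refine (mul_le_of_le_one_left hP hW1).trans ?_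
      have hR : 0 ≤ r ^ (-(k + l)) := by positivity
      rw [mul_add]
      rcases le_total ‖z - x‖ ‖z - y‖ with h | h
      · have := prod_le_aux2 _ _ r k l hA hr0 h (by linarith) hl0
        nlinarith [mul_nonneg hR h3]
      · have := prod_le_aux2 _ _ r l k hB hr0 h (by linarith) hk0
        rw [add_comm l k] at this
        nlinarith [mul_nonneg hR h2]
    · rw [integral_const_mul, integral_add hx hy, scaled_integral n k l r hr0,
        scaled_integral n l k r hr0, ← hJ1, ← hJ2, ← mul_add, ← mul_assoc,
        ← Real.rpow_natCast r n, ← Real.rpow_add hr0,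
        show -(k + l) + (n : ℝ) = -p by linarith, hr, Real.div_rpow hd.le zero_le_two,
        Real.rpow_neg zero_le_two, div_inv_eq_mul]
      have : 0 ≤ ‖x - y‖ ^ (-p) := by positivity
      nlinarith
end

section
/- Let a₀, a₁, a₂, δ be real numbers with 0 ≤ a₀ < 4, −1/2 ≤ a₁ < 4, −1/2 ≤ a₂ < 4, a₀ + a₁ + a₂ < 10 and δ > 5. Then there is a constant C such that for every x ∈ ℝ⁴: ( ∫_{ℝ⁴} | ∫_{ℝ⁴} ∫_{ℝ⁴} ⟨x₁⟩^{−δ} ⟨x₂⟩^{−δ} ⟨x₃⟩^{−δ/2} |x − x₁|^{−a₀} |x₁ − x₂|^{−a₁} |x₂ − x₃|^{−a₂} dx₁ dx₂ |² dx₃ )^{1/2} ≤ C. -/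
open MeasureTheory

/-- Abstract weighted Young inequality. -/
lemma aux_young {E : Type*} [NormedAddCommGroup E] [MeasurableSpace E] [BorelSpace E]
    [SecondCountableTopology E] (μ : Measure E) [SFinite μ]
    (A₀ A₁ A₂ : E → ENNReal) (m₀ : Measurable A₀) (m₁ : Measurable A₁) (m₂ : Measurable A₂)
    (M : ENNReal)
    (b₀ : ∀ z, ∫⁻ y, A₀ (z - y) ∂μ ≤ M) (b₁ : ∀ z, ∫⁻ y, A₁ (z - y) ∂μ ≤ M)
    (b₂ : ∀ z, ∫⁻ y, A₂ (z - y) ∂μ ≤ M)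
    (e₁ : ∀ y, A₁ (-y) = A₁ y) (e₂ : ∀ y, A₂ (-y) = A₂ y)
    (f : E → E → E → E → ENNReal)
    (hf : ∀ x x₁ x₂ x₃, f x x₁ x₂ x₃ ≤
      (A₁ (x₁ - x₂) * A₂ (x₂ - x₃) + A₀ (x - x₁) * A₂ (x₂ - x₃)
        + A₀ (x - x₁) * A₁ (x₁ - x₂)) ^ ((1:ℝ)/2) *
      (A₀ (x - x₁) * A₁ (x₁ - x₂) * A₂ (x₂ - x₃)) ^ ((1:ℝ)/2)) (x : E) :
    ∫⁻ x₃, (∫⁻ x₂, ∫⁻ x₁, f x x₁ x₂ x₃ ∂μ ∂μ) ^ 2 ∂μ ≤ 3 * M ^ 2 * M ^ 3 := by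
  have b₁' : ∀ z, ∫⁻ y, A₁ (y - z) ∂μ ≤ M := fun z => by
    refine le_trans (le_of_eq (lintegral_congr fun y => ?_)) (b₁ z)
    rw [← e₁, neg_sub]
  have b₂' : ∀ z, ∫⁻ y, A₂ (y - z) ∂μ ≤ M := fun z => by
    refine le_trans (le_of_eq (lintegral_congr fun y => ?_)) (b₂ z)
    rw [← e₂, neg_sub]
  have h01 : ∫⁻ x₂, ∫⁻ x₁, A₀ (x - x₁) * A₁ (x₁ - x₂) ∂μ ∂μ ≤ M * M := by
    rw [lintegral_lintegral_swap (by unfold Function.uncurry; fun_prop)]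
    calc _ = ∫⁻ x₁, A₀ (x - x₁) * ∫⁻ x₂, A₁ (x₁ - x₂) ∂μ ∂μ :=
          lintegral_congr fun x₁ => lintegral_const_mul _ (by fun_prop)
      _ ≤ ∫⁻ x₁, A₀ (x - x₁) * M ∂μ := by gcongr; apply b₁
      _ = (∫⁻ x₁, A₀ (x - x₁) ∂μ) * M := lintegral_mul_const _ (by fun_prop)
      _ ≤ _ := by gcongr; apply b₀
  have h02 : ∀ x₃, ∫⁻ x₂, ∫⁻ x₁, A₀ (x - x₁) * A₂ (x₂ - x₃) ∂μ ∂μ ≤ M * M := fun x₃ => by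
    calc _ = ∫⁻ x₂, (∫⁻ x₁, A₀ (x - x₁) ∂μ) * A₂ (x₂ - x₃) ∂μ :=
          lintegral_congr fun x₁ => lintegral_mul_const _ (by fun_prop)
      _ ≤ ∫⁻ x₂, M * A₂ (x₂ - x₃) ∂μ := by gcongr; apply b₀
      _ = M * ∫⁻ x₂, A₂ (x₂ - x₃) ∂μ := lintegral_const_mul _ (by fun_prop)
      _ ≤ _ := by gcongr; apply b₂'
  have h12 : ∀ x₃, ∫⁻ x₂, ∫⁻ x₁, A₁ (x₁ - x₂) * A₂ (x₂ - x₃) ∂μ ∂μ ≤ M * M := fun x₃ => by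
    calc _ = ∫⁻ x₂, (∫⁻ x₁, A₁ (x₁ - x₂) ∂μ) * A₂ (x₂ - x₃) ∂μ :=
          lintegral_congr fun x₁ => lintegral_mul_const _ (by fun_prop)
      _ ≤ ∫⁻ x₂, M * A₂ (x₂ - x₃) ∂μ := by gcongr; apply b₁'
      _ = M * ∫⁻ x₂, A₂ (x₂ - x₃) ∂μ := lintegral_const_mul _ (by fun_prop)
      _ ≤ _ := by gcongr; apply b₂'
  have hP : ∀ x₃, ∫⁻ x₂, ∫⁻ x₁, (A₁ (x₁ - x₂) * A₂ (x₂ - x₃) + A₀ (x - x₁) * A₂ (x₂ - x₃)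
        + A₀ (x - x₁) * A₁ (x₁ - x₂)) ∂μ ∂μ ≤ 3 * M ^ 2 := fun x₃ => by
    have mm : Measurable fun x₂ => ∫⁻ x₁, A₀ (x - x₁) * A₁ (x₁ - x₂) ∂μ :=
      Measurable.lintegral_prod_right' (f := fun p : E × E => A₀ (x - p.2) * A₁ (p.2 - p.1))
        (by fun_prop)
    calc _ = ∫⁻ x₂, (((∫⁻ x₁, A₁ (x₁ - x₂) * A₂ (x₂ - x₃) ∂μ) +
            ∫⁻ x₁, A₀ (x - x₁) * A₂ (x₂ - x₃) ∂μ) + ∫⁻ x₁, A₀ (x - x₁) * A₁ (x₁ - x₂) ∂μ) ∂μ := by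
          refine lintegral_congr fun x₂ => ?_
          rw [lintegral_add_left (by fun_prop), lintegral_add_left (by fun_prop)]
      _ = ((∫⁻ x₂, ∫⁻ x₁, A₁ (x₁ - x₂) * A₂ (x₂ - x₃) ∂μ ∂μ) +
            ∫⁻ x₂, ∫⁻ x₁, A₀ (x - x₁) * A₂ (x₂ - x₃) ∂μ ∂μ) +
            ∫⁻ x₂, ∫⁻ x₁, A₀ (x - x₁) * A₁ (x₁ - x₂) ∂μ ∂μ := by
          rw [lintegral_add_right _ mm, lintegral_add_right]
          exact Measurable.lintegral_prod_right'
            (f := fun p : E × E => A₀ (x - p.2) * A₂ (p.1 - x₃)) (by fun_prop)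
      _ ≤ (M * M + M * M) + M * M := by gcongr; exacts [h12 x₃, h02 x₃]
      _ = _ := by ring
  have hQ : ∫⁻ x₃, ∫⁻ x₂, ∫⁻ x₁, A₀ (x - x₁) * A₁ (x₁ - x₂) * A₂ (x₂ - x₃) ∂μ ∂μ ∂μ ≤ M ^ 3 := by
    have mm : Measurable fun x₂ => ∫⁻ x₁, A₀ (x - x₁) * A₁ (x₁ - x₂) ∂μ :=
      Measurable.lintegral_prod_right' (f := fun p : E × E => A₀ (x - p.2) * A₁ (p.2 - p.1))
        (by fun_prop)
    calc _ = ∫⁻ x₃, ∫⁻ x₂, (∫⁻ x₁, A₀ (x - x₁) * A₁ (x₁ - x₂) ∂μ) * A₂ (x₂ - x₃) ∂μ ∂μ :=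
          lintegral_congr fun x₃ => lintegral_congr fun x₂ => lintegral_mul_const _ (by fun_prop)
      _ = ∫⁻ x₂, ∫⁻ x₃, (∫⁻ x₁, A₀ (x - x₁) * A₁ (x₁ - x₂) ∂μ) * A₂ (x₂ - x₃) ∂μ ∂μ := by
          rw [lintegral_lintegral_swap]
          apply Measurable.aemeasurable
          exact (mm.comp measurable_snd).mul (by fun_prop)
      _ = ∫⁻ x₂, (∫⁻ x₁, A₀ (x - x₁) * A₁ (x₁ - x₂) ∂μ) * ∫⁻ x₃, A₂ (x₂ - x₃) ∂μ ∂μ :=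
          lintegral_congr fun x₂ => lintegral_const_mul _ (by fun_prop)
      _ ≤ ∫⁻ x₂, (∫⁻ x₁, A₀ (x - x₁) * A₁ (x₁ - x₂) ∂μ) * M ∂μ := by gcongr; apply b₂
      _ = (∫⁻ x₂, ∫⁻ x₁, A₀ (x - x₁) * A₁ (x₁ - x₂) ∂μ ∂μ) * M := lintegral_mul_const _ mm
      _ ≤ M * M * M := by gcongr
      _ = _ := by ring
  have hCS : ∀ x₃, (∫⁻ x₂, ∫⁻ x₁, f x x₁ x₂ x₃ ∂μ ∂μ) ^ 2 ≤ 3 * M ^ 2 *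
      ∫⁻ x₂, ∫⁻ x₁, A₀ (x - x₁) * A₁ (x₁ - x₂) * A₂ (x₂ - x₃) ∂μ ∂μ := fun x₃ => by
    set P : E × E → ENNReal := fun p => A₁ (p.2 - p.1) * A₂ (p.1 - x₃) +
      A₀ (x - p.2) * A₂ (p.1 - x₃) + A₀ (x - p.2) * A₁ (p.2 - p.1) with hPd
    set Q : E × E → ENNReal := fun p => A₀ (x - p.2) * A₁ (p.2 - p.1) * A₂ (p.1 - x₃) with hQd
    have mP : Measurable P := by fun_prop
    have mQ : Measurable Q := by fun_prop
    have h1 : ∫⁻ x₂, ∫⁻ x₁, f x x₁ x₂ x₃ ∂μ ∂μ ≤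
        (∫⁻ p, P p ∂(μ.prod μ)) ^ ((1:ℝ)/2) * (∫⁻ p, Q p ∂(μ.prod μ)) ^ ((1:ℝ)/2) := by
      calc _ ≤ ∫⁻ x₂, ∫⁻ x₁, P (x₂, x₁) ^ ((1:ℝ)/2) * Q (x₂, x₁) ^ ((1:ℝ)/2) ∂μ ∂μ := by
            gcongr; apply hf
        _ = ∫⁻ p, ((fun p => P p ^ ((1:ℝ)/2)) * (fun p => Q p ^ ((1:ℝ)/2))) p ∂(μ.prod μ) := by
            rw [lintegral_prod _ (by fun_prop)]; rfl
        _ ≤ _ := by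
            refine (ENNReal.lintegral_mul_le_Lp_mul_Lq (μ.prod μ) Real.HolderConjugate.two_two
              (by fun_prop) (by fun_prop)).trans (le_of_eq ?_)
            simp only [← ENNReal.rpow_mul]
            norm_num
    calc _ ≤ ((∫⁻ p, P p ∂(μ.prod μ)) ^ ((1:ℝ)/2) * (∫⁻ p, Q p ∂(μ.prod μ)) ^ ((1:ℝ)/2)) ^ 2 := by
          gcongr
      _ = (∫⁻ p, P p ∂(μ.prod μ)) * (∫⁻ p, Q p ∂(μ.prod μ)) := by
          rw [mul_pow, ← ENNReal.rpow_natCast, ← ENNReal.rpow_natCast, ← ENNReal.rpow_mul,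
            ← ENNReal.rpow_mul]
          norm_num
      _ ≤ _ := by
          rw [lintegral_prod _ mP.aemeasurable, lintegral_prod _ mQ.aemeasurable]
          gcongr
          exact hP x₃
  calc _ ≤ ∫⁻ x₃, 3 * M ^ 2 *
      ∫⁻ x₂, ∫⁻ x₁, A₀ (x - x₁) * A₁ (x₁ - x₂) * A₂ (x₂ - x₃) ∂μ ∂μ ∂μ := lintegral_mono hCS
    _ = 3 * M ^ 2 * ∫⁻ x₃, 
      ∫⁻ x₂, ∫⁻ x₁, A₀ (x - x₁) * A₁ (x₁ - x₂) * A₂ (x₂ - x₃) ∂μ ∂μ ∂μ := by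
        apply lintegral_const_mul
        refine Measurable.lintegral_prod_right' (f := fun p : E × E =>
          ∫⁻ x₁, A₀ (x - x₁) * A₁ (x₁ - p.2) * A₂ (p.2 - p.1) ∂μ) ?_
        exact Measurable.lintegral_prod_right' (f := fun p : (E × E) × E =>
          A₀ (x - p.2) * A₁ (p.2 - p.1.2) * A₂ (p.1.2 - p.1.1)) (by fun_prop)
    _ ≤ _ := by gcongr

local notation "E4" => EuclideanSpace ℝ (Fin 4)

lemma aux_weight {r : ℝ} (hr : 4 < r) :
    ∫⁻ y : E4, ENNReal.ofReal (Real.sqrt (1 + ‖y‖ ^ 2) ^ (-r)) < ⊤ := by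
  have h := (integrable_rpow_neg_one_add_norm_sq (E := E4) (μ := volume) (r := r)
    (by simpa using hr)).lintegral_lt_top
  refine lt_of_le_of_lt (le_of_eq (lintegral_congr fun y => ?_)) h
  rw [Real.sqrt_eq_rpow, ← Real.rpow_mul (by positivity)]
  ring_nf

lemma aux_kernel {r c : ℝ} (hr : 4 < r) (hc0 : 0 ≤ c) (hc : c < 4) :
    ∃ M : ENNReal, M ≠ ⊤ ∧ ∀ z : E4, ∫⁻ y : E4, ENNReal.ofReal (Real.sqrt (1 + ‖y‖ ^ 2) ^ (-r)) *
      ENNReal.ofReal (1 + ‖z - y‖ ^ (-c)) ≤ M := by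
  set κ : E4 → ENNReal := (Metric.ball (0:E4) 1).indicator fun y => ENNReal.ofReal (‖y‖ ^ (-c))
    with hκ
  have mκ : Measurable κ := by
    apply Measurable.indicator (by fun_prop) measurableSet_ball
  have hfin : ∫⁻ y, κ y ≠ ⊤ := by
    rw [hκ, lintegral_indicator measurableSet_ball]
    have : IntegrableOn (fun y : E4 => ‖y‖ ^ (-c)) (Metric.ball 0 1) volume := by
      apply integrableOn_ball_of_norm_le_rpow (C := 1) (α := c) (by simp) (by simpa using hc)
      · refine Filter.Eventually.of_forall fun y => ?_
        rw [Real.norm_of_nonneg (by positivity), one_mul]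
      · apply Measurable.aestronglyMeasurable; fun_prop
    exact this.lintegral_lt_top.ne
  refine ⟨2 * (∫⁻ y : E4, ENNReal.ofReal (Real.sqrt (1 + ‖y‖ ^ 2) ^ (-r))) + ∫⁻ y, κ y, ?_, ?_⟩
  · exact ENNReal.add_ne_top.2 ⟨ENNReal.mul_ne_top (by simp) (aux_weight hr).ne, hfin⟩
  intro z
  calc _ ≤ ∫⁻ y : E4, (2 * ENNReal.ofReal (Real.sqrt (1 + ‖y‖ ^ 2) ^ (-r)) + κ (z - y)) := by
        refine lintegral_mono fun y => ?_
        have hw : ENNReal.ofReal (Real.sqrt (1 + ‖y‖ ^ 2) ^ (-r)) ≤ 1 := by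
          rw [ENNReal.ofReal_le_one]
          apply Real.rpow_le_one_of_one_le_of_nonpos _ (by linarith)
          rw [Real.one_le_sqrt]; nlinarith [norm_nonneg y]
        have hk : ENNReal.ofReal (1 + ‖z - y‖ ^ (-c)) ≤ 2 + κ (z - y) := by
          rw [hκ]
          by_cases h : z - y ∈ Metric.ball (0:E4) 1
          · rw [Set.indicator_of_mem h, ENNReal.ofReal_add (by norm_num) (by positivity)]
            gcongr; simp
          · rw [Set.indicator_of_notMem h, add_zero]
            have : (2:ENNReal) = ENNReal.ofReal 2 := by simp
            refine le_trans (ENNReal.ofReal_le_ofReal ?_) this.ge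
            have := Real.rpow_le_one_of_one_le_of_nonpos (x := ‖z - y‖) (z := -c)
              (by simpa using h) (by linarith)
            linarith
        calc _ ≤ ENNReal.ofReal (Real.sqrt (1 + ‖y‖ ^ 2) ^ (-r)) * (2 + κ (z - y)) := by gcongr
          _ = 2 * ENNReal.ofReal (Real.sqrt (1 + ‖y‖ ^ 2) ^ (-r)) +
            ENNReal.ofReal (Real.sqrt (1 + ‖y‖ ^ 2) ^ (-r)) * κ (z - y) := by ring
          _ ≤ _ := by gcongr; exact mul_le_of_le_one_left' hw
    _ = _ := by
        rw [lintegral_add_right _ (by fun_prop), lintegral_const_mul _ (by fun_prop)]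
        rw [lintegral_sub_left_eq_self κ z]

/-- Pointwise: product of powers squared against kernels. -/
lemma aux_pointwise {A B C s t u : ℝ} (hA : 0 < A) (hB : 0 < B) (hC : 0 < C)
    (hs : s ≤ 1) (ht : t ≤ 1) (hu : u ≤ 1) (hsum : s + t + u = 5 / 2) :
    (A ^ s * B ^ t * C ^ u) ^ 2 ≤ (B * C + A * C + A * B) * (A * B * C) := by
  have h := Real.geom_mean_le_arith_mean3_weighted (w₁ := 2 * (1 - s)) (w₂ := 2 * (1 - t))
    (w₃ := 2 * (1 - u)) (p₁ := B * C) (p₂ := A * C) (p₃ := A * B) (by linarith) (by linarith)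
    (by linarith) (by positivity) (by positivity) (by positivity) (by linarith)
  have h2 : (A ^ s * B ^ t * C ^ u) ^ 2 = ((B * C) ^ (2 * (1 - s)) * (A * C) ^ (2 * (1 - t)) *
      (A * B) ^ (2 * (1 - u))) * (A * B * C) := by
    rw [Real.mul_rpow hB.le hC.le, Real.mul_rpow hA.le hC.le, Real.mul_rpow hA.le hB.le]
    have e : ∀ X : ℝ, 0 < X → ∀ p q r : ℝ, p + q + 1 = 2 * r → X ^ p * X ^ q * X = (X ^ r) ^ 2 := by
      intro X hX p q r h
      rw [← Real.rpow_natCast, ← Real.rpow_mul hX.le, ← Real.rpow_add hX]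
      nth_rewrite 2 [← Real.rpow_one X]
      rw [← Real.rpow_add hX, h]; push_cast; ring_nf
    rw [mul_pow, mul_pow, ← e A hA (2 * (1 - t)) (2 * (1 - u)) s (by linarith),
      ← e B hB (2 * (1 - s)) (2 * (1 - u)) t (by linarith),
      ← e C hC (2 * (1 - s)) (2 * (1 - t)) u (by linarith)]
    ring
  rw [h2]
  gcongr
  have hBC : 0 < B * C := by positivity
  have hAC : 0 < A * C := by positivity
  have hAB : 0 < A * B := by positivity
  refine h.trans ?_
  have := mul_le_of_le_one_left hBC.le (show 2 * (1 - s) ≤ 1 by linarith)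
  have := mul_le_of_le_one_left hAC.le (show 2 * (1 - t) ≤ 1 by linarith)
  have := mul_le_of_le_one_left hAB.le (show 2 * (1 - u) ≤ 1 by linarith)
  linarith

lemma aux_exps {b₀ b₁ b₂ : ℝ} (h₀ : b₀ < 4) (h₁ : b₁ < 4) (h₂ : b₂ < 4) 
    (p₀ : 0 ≤ b₀) (p₁ : 0 ≤ b₁) (p₂ : 0 ≤ b₂)  (hs : b₀ + b₁ + b₂ < 10) :
    ∃ s t u : ℝ, s ≤ 1 ∧ t ≤ 1 ∧ u ≤ 1 ∧ s + t + u = 5 / 2 ∧ 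
      0 < s ∧ 0 < t ∧ 0 < u ∧ b₀ / s < 4 ∧ b₁ / t < 4 ∧ b₂ / u < 4 := by
  set D := 12 - (b₀ + b₁ + b₂) with hD
  have hDp : 0 < D := by linarith
  set l := 2 / D with hl
  have hl0 : 0 < l := by positivity
  have hl1 : l < 1 := by rw [hl, div_lt_one hDp]; linarith
  have hlD : l * D = 2 := by rw [hl]; field_simp
  have a : ∀ b : ℝ, 0 ≤ b → b < 4 → 1 - l * (1 - b / 4) ≤ 1 ∧ 0 < 1 - l * (1 - b / 4) ∧
      b / (1 - l * (1 - b / 4)) < 4 := by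
    intro b hb hb4
    have q : 0 < 1 - l * (1 - b / 4) := by nlinarith
    refine ⟨by nlinarith, q, ?_⟩
    rw [div_lt_iff₀ q]; nlinarith
  refine ⟨_, _, _, (a b₀ p₀ h₀).1, (a b₁ p₁ h₁).1, (a b₂ p₂ h₂).1, ?_, (a b₀ p₀ h₀).2.1,
    (a b₁ p₁ h₁).2.1, (a b₂ p₂ h₂).2.1, (a b₀ p₀ h₀).2.2, (a b₁ p₁ h₁).2.2, (a b₂ p₂ h₂).2.2⟩
  rw [hD] at hlD; nlinarith

lemma aux_pow {n b s : ℝ} (hn : 0 ≤ n) (hs : 0 < s) : n ^ (-b) ≤ (1 + n ^ (-(b / s))) ^ s := by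
  have : n ^ (-b) = (n ^ (-(b / s))) ^ s := by
    rw [← Real.rpow_mul hn]; congr 1; field_simp
  rw [this]
  apply Real.rpow_le_rpow (by positivity) (by linarith) hs.le

lemma aux_one_le (y : E4) : 1 ≤ Real.sqrt (1 + ‖y‖ ^ 2) := by
  rw [Real.one_le_sqrt]; nlinarith [norm_nonneg y]

lemma aux_grow {a s : ℝ} (ha : -(1/2) ≤ a) (hs : 0 < s) (y z : E4) :
    ‖y - z‖ ^ (-a) ≤ (Real.sqrt (1 + ‖y‖ ^ 2)) ^ ((1:ℝ)/2) * (Real.sqrt (1 + ‖z‖ ^ 2)) ^ ((1:ℝ)/2) *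
      (1 + ‖y - z‖ ^ (-(max a 0 / s))) ^ s := by
  have hy := aux_one_le y
  have hz := aux_one_le z
  have hyz : 1 ≤ Real.sqrt (1 + ‖y‖ ^ 2) * Real.sqrt (1 + ‖z‖ ^ 2) :=
    one_le_mul_of_one_le_of_one_le hy hz
  rw [← Real.mul_rpow (by positivity) (by positivity)]
  have h1 := Real.one_le_rpow hyz (show (0:ℝ) ≤ 1/2 by norm_num)
  rcases le_total 0 a with h | h
  · rw [max_eq_left h]
    refine (aux_pow (norm_nonneg _) hs).trans ?_
    exact le_mul_of_one_le_left (by positivity) h1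
  · have h2 : 1 ≤ (1 + ‖y - z‖ ^ (-(max a 0 / s))) ^ s :=
      Real.one_le_rpow (by linarith [Real.rpow_nonneg (norm_nonneg (y - z)) (-(max a 0 / s))]) hs.le
    refine le_trans ?_ (le_mul_of_one_le_right (by positivity) h2)
    have h3 : ‖y - z‖ ≤ Real.sqrt (1 + ‖y‖ ^ 2) * Real.sqrt (1 + ‖z‖ ^ 2) := by
      rw [← Real.sqrt_mul (by positivity)]
      apply Real.le_sqrt_of_sq_le
      have := norm_sub_le y z
      have h4 : ‖y - z‖ ^ 2 ≤ (‖y‖ + ‖z‖) ^ 2 := by gcongr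
      nlinarith [sq_nonneg (1 - ‖y‖ * ‖z‖)]
    calc ‖y - z‖ ^ (-a) ≤ (Real.sqrt (1 + ‖y‖ ^ 2) * Real.sqrt (1 + ‖z‖ ^ 2)) ^ (-a) :=
          Real.rpow_le_rpow (norm_nonneg _) h3 (by linarith)
      _ ≤ _ := Real.rpow_le_rpow_of_exponent_le hyz (by linarith)

theorem stmt5 (a₀ a₁ a₂ δ : ℝ)
    (h₀ : 0 ≤ a₀) (h₀' : a₀ < 4)
    (h₁ : -(1/2) ≤ a₁) (h₁' : a₁ < 4)
    (h₂ : -(1/2) ≤ a₂) (h₂' : a₂ < 4)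
    (hsum : a₀ + a₁ + a₂ < 10) (hδ : 5 < δ) :
    ∃ C : ℝ, 0 < C ∧ ∀ x : EuclideanSpace ℝ (Fin 4),
      (∫⁻ x₃ : EuclideanSpace ℝ (Fin 4),
          (∫⁻ x₂ : EuclideanSpace ℝ (Fin 4), ∫⁻ x₁ : EuclideanSpace ℝ (Fin 4),
              ENNReal.ofReal
                (Real.sqrt (1 + ‖x₁‖ ^ 2) ^ (-δ) * Real.sqrt (1 + ‖x₂‖ ^ 2) ^ (-δ) *
                  Real.sqrt (1 + ‖x₃‖ ^ 2) ^ (-(δ / 2)) *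
                  (‖x - x₁‖ ^ (-a₀) * ‖x₁ - x₂‖ ^ (-a₁) * ‖x₂ - x₃‖ ^ (-a₂)))) ^ 2)
        ^ ((1 : ℝ) / 2) ≤ ENNReal.ofReal C := by
  obtain ⟨s, t, u, hs1, ht1, hu1, hstu, hs, ht, hu, hbs, hbt, hbu⟩ :=
    aux_exps (b₀ := a₀) (b₁ := max a₁ 0) (b₂ := max a₂ 0) h₀' (by simp [h₁']) (by simp [h₂'])
      h₀ (by simp) (by simp) (by
        rcases max_cases a₁ 0 with h | h <;> rcases max_cases a₂ 0 with h' | h' <;> linarith)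
  set c₀ := a₀ / s
  set c₁ := max a₁ 0 / t
  set c₂ := max a₂ 0 / u
  have hr : 4 < δ - 1 := by linarith
  obtain ⟨M₀, hM₀, k₀⟩ := aux_kernel hr (show 0 ≤ c₀ by positivity) hbs
  obtain ⟨M₁, hM₁, k₁⟩ := aux_kernel hr (show 0 ≤ c₁ by positivity) hbt
  obtain ⟨M₂, hM₂, k₂⟩ := aux_kernel hr (show 0 ≤ c₂ by positivity) hbu
  set W : E4 → ENNReal := fun y => ENNReal.ofReal (Real.sqrt (1 + ‖y‖ ^ 2) ^ (-(δ - 1))) with hW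
  have mW : Measurable W := by fun_prop
  set M := M₀ + M₁ + M₂
  have hM : M ≠ ⊤ := by simp [M, hM₀, hM₁, hM₂]
  set μ : Measure E4 := volume.withDensity W with hμ
  have wd : ∀ g : E4 → ENNReal, Measurable g → ∫⁻ a, g a ∂μ = ∫⁻ a, W a * g a := fun g hg => by
    rw [hμ, lintegral_withDensity_eq_lintegral_mul _ mW hg]; rfl
  have kk : ∀ (c : ℝ) (N : ENNReal), (∀ z : E4, ∫⁻ y : E4, ENNReal.ofReal (Real.sqrt (1 + ‖y‖ ^ 2) ^ (-(δ - 1))) *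
      ENNReal.ofReal (1 + ‖z - y‖ ^ (-c)) ≤ N) → N ≤ M → 
      ∀ z : E4, ∫⁻ y, ENNReal.ofReal (1 + ‖z - y‖ ^ (-c)) ∂μ ≤ M := by
    intro c N h hN z
    rw [wd _ (by fun_prop)]
    exact (h z).trans hN
  set F : E4 → E4 → E4 → E4 → ENNReal := fun x x₁ x₂ x₃ => ENNReal.ofReal
    ((1 + ‖x - x₁‖ ^ (-c₀)) ^ s * (1 + ‖x₁ - x₂‖ ^ (-c₁)) ^ t * (1 + ‖x₂ - x₃‖ ^ (-c₂)) ^ u) with hF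
  have key := aux_young μ (fun y => ENNReal.ofReal (1 + ‖y‖ ^ (-c₀)))
    (fun y => ENNReal.ofReal (1 + ‖y‖ ^ (-c₁))) (fun y => ENNReal.ofReal (1 + ‖y‖ ^ (-c₂)))
    (by fun_prop) (by fun_prop) (by fun_prop) M
    (kk c₀ M₀ k₀ (by simp only [M, add_assoc]; exact le_self_add))
    (kk c₁ M₁ k₁ (by simp only [M, add_assoc]; exact le_add_left le_self_add))
    (kk c₂ M₂ k₂ (by simp only [M]; exact le_add_self))
    (by simp) (by simp) F (by
      intro x x₁ x₂ x₃
      have hA : 0 < 1 + ‖x - x₁‖ ^ (-c₀) := by positivity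
      have hB : 0 < 1 + ‖x₁ - x₂‖ ^ (-c₁) := by positivity
      have hC : 0 < 1 + ‖x₂ - x₃‖ ^ (-c₂) := by positivity
      have h := aux_pointwise hA hB hC hs1 ht1 hu1 hstu
      simp only [hF]
      generalize 1 + ‖x - x₁‖ ^ (-c₀) = A at *
      generalize 1 + ‖x₁ - x₂‖ ^ (-c₁) = B at *
      generalize 1 + ‖x₂ - x₃‖ ^ (-c₂) = C at *
      rw [← ENNReal.mul_rpow_of_nonneg _ _ (by norm_num), ← ENNReal.ofReal_mul hB.le,
        ← ENNReal.ofReal_mul hA.le, ← ENNReal.ofReal_mul hA.le, 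
        ← ENNReal.ofReal_add (by positivity) (by positivity), 
        ← ENNReal.ofReal_add (by positivity) (by positivity),
        ← ENNReal.ofReal_mul (by positivity), ← ENNReal.ofReal_mul (by positivity),
        ENNReal.ofReal_rpow_of_nonneg (by positivity) (by norm_num)]
      apply ENNReal.ofReal_le_ofReal
      rw [← Real.sqrt_eq_rpow]
      exact Real.le_sqrt_of_sq_le h)
  have mF : ∀ x x₂ x₃, Measurable fun x₁ => F x x₁ x₂ x₃ := by
    intro x x₂ x₃; simp only [hF]; fun_prop
  have mF2 : ∀ x x₃, Measurable fun x₂ => ∫⁻ x₁, F x x₁ x₂ x₃ ∂μ := by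
    intro x x₃
    apply Measurable.lintegral_prod_right' (f := fun p : E4 × E4 => F x p.2 p.1 x₃)
    simp only [hF]; fun_prop
  have mF3 : ∀ x, Measurable fun x₃ => ∫⁻ x₂, ∫⁻ x₁, F x x₁ x₂ x₃ ∂μ ∂μ := by
    intro x
    apply Measurable.lintegral_prod_right' (f := fun p : E4 × E4 => ∫⁻ x₁, F x x₁ p.2 p.1 ∂μ)
    apply Measurable.lintegral_prod_right' (f := fun p : (E4 × E4) × E4 => F x p.2 p.1.2 p.1.1)
    simp only [hF]; fun_prop
  have main : ∀ x : E4, (∫⁻ x₃ : E4, (∫⁻ x₂ : E4, ∫⁻ x₁ : E4,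
              ENNReal.ofReal
                (Real.sqrt (1 + ‖x₁‖ ^ 2) ^ (-δ) * Real.sqrt (1 + ‖x₂‖ ^ 2) ^ (-δ) *
                  Real.sqrt (1 + ‖x₃‖ ^ 2) ^ (-(δ / 2)) *
                  (‖x - x₁‖ ^ (-a₀) * ‖x₁ - x₂‖ ^ (-a₁) * ‖x₂ - x₃‖ ^ (-a₂)))) ^ 2)
      ≤ 3 * M ^ 2 * M ^ 3 := by
    intro x
    refine le_trans ?_ (key x)
    rw [wd _ ((mF3 x).pow_const 2)]
    refine lintegral_mono fun x₃ => ?_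
    set v : ENNReal := ENNReal.ofReal (Real.sqrt (1 + ‖x₃‖ ^ 2) ^ (-((δ - 1) / 2))) with hv
    have hv2 : W x₃ = v ^ 2 := by
      rw [hW, hv, ← ENNReal.ofReal_pow (by positivity), ← Real.rpow_natCast,
        ← Real.rpow_mul (by positivity)]
      push_cast; ring_nf
    rw [hv2, ← mul_pow]
    gcongr
    rw [wd _ (mF2 x x₃),
      ← lintegral_const_mul' _ _ (by simp [hv])]
    refine lintegral_mono fun x₂ => ?_
    rw [wd _ (mF x x₂ x₃),
      ← mul_assoc, ← lintegral_const_mul' _ _ (by simp [hv, hW, ENNReal.mul_eq_top])]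
    refine lintegral_mono fun x₁ => ?_
    simp only [hF, hv, hW]
    rw [← ENNReal.ofReal_mul (by positivity), ← ENNReal.ofReal_mul (by positivity),
      ← ENNReal.ofReal_mul (by positivity)]
    apply ENNReal.ofReal_le_ofReal
    have g0 := aux_pow (b := a₀) (norm_nonneg (x - x₁)) hs
    have g1 := aux_grow h₁ ht x₁ x₂
    have g2 := aux_grow h₂ hu x₂ x₃
    have o1 := aux_one_le x₁
    have o2 := aux_one_le x₂
    have o3 := aux_one_le x₃
    have hA : 0 ≤ (1 + ‖x - x₁‖ ^ (-c₀)) ^ s := by positivity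
    have hB : 0 ≤ (1 + ‖x₁ - x₂‖ ^ (-c₁)) ^ t := by positivity
    have hC : 0 ≤ (1 + ‖x₂ - x₃‖ ^ (-c₂)) ^ u := by positivity
    change _ ≤ (1 + ‖x - x₁‖ ^ (-c₀)) ^ s at g0
    change _ ≤ _ * (1 + ‖x₁ - x₂‖ ^ (-c₁)) ^ t at g1
    change _ ≤ _ * (1 + ‖x₂ - x₃‖ ^ (-c₂)) ^ u at g2
    have n0 : 0 ≤ ‖x - x₁‖ ^ (-a₀) := by positivity
    have n1 : 0 ≤ ‖x₁ - x₂‖ ^ (-a₁) := by positivity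
    have n2 : 0 ≤ ‖x₂ - x₃‖ ^ (-a₂) := by positivity
    generalize (1 + ‖x - x₁‖ ^ (-c₀)) ^ s = A at *
    generalize (1 + ‖x₁ - x₂‖ ^ (-c₁)) ^ t = B at *
    generalize (1 + ‖x₂ - x₃‖ ^ (-c₂)) ^ u = C at *
    generalize ‖x - x₁‖ ^ (-a₀) = f0 at *
    generalize ‖x₁ - x₂‖ ^ (-a₁) = f1 at *
    generalize ‖x₂ - x₃‖ ^ (-a₂) = f2 at *
    generalize Real.sqrt (1 + ‖x₁‖ ^ 2) = j1 at *
    generalize Real.sqrt (1 + ‖x₂‖ ^ 2) = j2 at *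
    generalize Real.sqrt (1 + ‖x₃‖ ^ 2) = j3 at *
    have p1 : 0 < j1 := by linarith
    have p2 : 0 < j2 := by linarith
    have p3 : 0 < j3 := by linarith
    have w1 : j1 ^ (-δ) * j1 ^ ((1:ℝ)/2) ≤ j1 ^ (-(δ - 1)) := by
      rw [← Real.rpow_add p1]
      exact Real.rpow_le_rpow_of_exponent_le o1 (by linarith)
    have w2 : j2 ^ (-δ) * (j2 ^ ((1:ℝ)/2) * j2 ^ ((1:ℝ)/2)) = j2 ^ (-(δ - 1)) := by
      rw [← Real.rpow_add p2, ← Real.rpow_add p2]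
      congr 1; ring
    have w3 : j3 ^ (-(δ/2)) * j3 ^ ((1:ℝ)/2) = j3 ^ (-((δ - 1)/2)) := by
      rw [← Real.rpow_add p3]
      congr 1; ring
    calc _ ≤ j1 ^ (-δ) * j2 ^ (-δ) * j3 ^ (-(δ / 2)) * (A * (j1 ^ ((1:ℝ)/2) * j2 ^ ((1:ℝ)/2) * B) *
          (j2 ^ ((1:ℝ)/2) * j3 ^ ((1:ℝ)/2) * C)) := by gcongr
      _ = (j3 ^ (-(δ/2)) * j3 ^ ((1:ℝ)/2)) * (j2 ^ (-δ) * (j2 ^ ((1:ℝ)/2) * j2 ^ ((1:ℝ)/2))) *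
          ((j1 ^ (-δ) * j1 ^ ((1:ℝ)/2)) * (A * B * C)) := by ring
      _ ≤ _ := by rw [w2, w3]; gcongr
  set R := (3 * M ^ 2 * M ^ 3) ^ ((1:ℝ)/2) with hR
  have hRt : R ≠ ⊤ := by
    apply ENNReal.rpow_ne_top_of_nonneg (by norm_num)
    exact ENNReal.mul_ne_top (ENNReal.mul_ne_top (by simp) (ENNReal.pow_ne_top hM))
      (ENNReal.pow_ne_top hM)
  refine ⟨R.toReal + 1, by positivity, fun x => ?_⟩
  calc _ ≤ R := ENNReal.rpow_le_rpow (main x) (by norm_num)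
    _ = ENNReal.ofReal R.toReal := (ENNReal.ofReal_toReal hRt).symm
    _ ≤ _ := ENNReal.ofReal_le_ofReal (by linarith)
end

section
/- Let a₀, a₁, a₂, a₃, δ be real numbers with 0 ≤ a₀ < 4, −1/2 ≤ a₁ < 4, −1/2 ≤ a₂ < 4, −1/2 ≤ a₃ < 4, a₀ + a₁ + a₂ + a₃ < 14 and δ > 5. Then there is a constant C such that for every x ∈ ℝ⁴: ( ∫_{ℝ⁴} | ∫_{ℝ⁴} ∫_{ℝ⁴} ∫_{ℝ⁴} ⟨x₁⟩^{−δ} ⟨x₂⟩^{−δ} ⟨x₃⟩^{−δ} ⟨x₄⟩^{−δ/2} |x − x₁|^{−a₀} |x₁ − x₂|^{−a₁} |x₂ − x₃|^{−a₂} |x₃ − x₄|^{−a₃} dx₁ dx₂ dx₃ |² dx₄ )^{1/2} ≤ C. -/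
open MeasureTheory
open scoped ENNReal

lemma kern_bound (c β : ℝ) (hc0 : 0 ≤ c) (hc : c < 4) (hβ : 4 < β) :
    ∃ M : ℝ≥0∞, M ≠ ∞ ∧ ∀ y : EuclideanSpace ℝ (Fin 4),
      ∫⁻ z : EuclideanSpace ℝ (Fin 4), ENNReal.ofReal (Real.sqrt (1 + ‖z‖ ^ 2) ^ (-β)) *
        ENNReal.ofReal (‖y - z‖ ^ (-c)) ≤ M := by
  have h1 : Integrable (fun z : EuclideanSpace ℝ (Fin 4) =>
      Real.sqrt (1 + ‖z‖ ^ 2) ^ (-β)) := by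
    have := integrable_rpow_neg_one_add_norm_sq (E := EuclideanSpace ℝ (Fin 4)) (μ := volume)
      (r := β) (by simpa using hβ)
    refine this.congr (Filter.Eventually.of_forall fun z => ?_)
    simp only
    rw [Real.sqrt_eq_rpow, ← Real.rpow_mul (by positivity)]
    congr 1; ring
  have h2 : LocallyIntegrable (fun z : EuclideanSpace ℝ (Fin 4) => ‖z‖ ^ (-c)) := by
    refine locallyIntegrable_of_norm_le_rpow (C := 1) (α := c) (by simp) (by simpa using hc)
      (Filter.Eventually.of_forall fun z => ?_)
      (by have : Measurable (fun z : EuclideanSpace ℝ (Fin 4) => ‖z‖ ^ (-c)) := by measurability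
          exact this.aestronglyMeasurable)
    rw [one_mul, Real.norm_of_nonneg (by positivity)]
  have h2' : IntegrableOn (fun z : EuclideanSpace ℝ (Fin 4) => ‖z‖ ^ (-c))
      (Metric.closedBall 0 1) := h2.integrableOn_isCompact (isCompact_closedBall _ _)
  have h3 := (integrable_indicator_iff (Metric.isClosed_closedBall.measurableSet)).2 h2'
  refine ⟨(∫⁻ z : EuclideanSpace ℝ (Fin 4), ENNReal.ofReal (Real.sqrt (1 + ‖z‖ ^ 2) ^ (-β))) +
    ∫⁻ z : EuclideanSpace ℝ (Fin 4), ENNReal.ofReal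
      ((Metric.closedBall 0 1).indicator (fun z : EuclideanSpace ℝ (Fin 4) => ‖z‖ ^ (-c)) z), 
      ENNReal.add_ne_top.2 ⟨h1.lintegral_lt_top.ne, h3.lintegral_lt_top.ne⟩, fun y => ?_⟩
  rw [← lintegral_sub_left_eq_self (fun z : EuclideanSpace ℝ (Fin 4) => ENNReal.ofReal
      ((Metric.closedBall 0 1).indicator (fun z : EuclideanSpace ℝ (Fin 4) => ‖z‖ ^ (-c)) z)) y,
    ← lintegral_add_left (by fun_prop)]
  refine lintegral_mono fun z => ?_
  have hw0 : 0 ≤ Real.sqrt (1 + ‖z‖ ^ 2) ^ (-β) := by positivity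
  have hw1 : Real.sqrt (1 + ‖z‖ ^ 2) ^ (-β) ≤ 1 :=
    Real.rpow_le_one_of_one_le_of_nonpos (Real.one_le_sqrt.2 (by nlinarith [sq_nonneg ‖z‖]))
      (by linarith)
  have hk0 : 0 ≤ ‖y - z‖ ^ (-c) := by positivity
  simp only
  rw [← ENNReal.ofReal_mul hw0]
  by_cases hz : y - z ∈ Metric.closedBall (0 : EuclideanSpace ℝ (Fin 4)) 1
  · rw [Set.indicator_of_mem hz]
    refine le_add_left (ENNReal.ofReal_le_ofReal ?_)
    nlinarith
  · rw [Set.indicator_of_notMem hz]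
    refine le_add_right (ENNReal.ofReal_le_ofReal ?_)
    have : ‖y - z‖ ^ (-c) ≤ 1 := by
      apply Real.rpow_le_one_of_one_le_of_nonpos _ (by linarith)
      simp at hz
      exact hz.le
    nlinarith

lemma pointwise_bound (k0 k1 k2 k3 t0 t1 t2 t3 : ℝ) (h0 : 0 ≤ k0) (h1 : 0 ≤ k1) (h2 : 0 ≤ k2)
    (h3 : 0 ≤ k3) (ht0 : 0 ≤ t0) (ht1 : 0 ≤ t1) (ht2 : 0 ≤ t2) (ht3 : 0 ≤ t3)
    (ht : t0 + t1 + t2 + t3 = 1) :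
    (k0 ^ (1 - t0 / 2) * k1 ^ (1 - t1 / 2) * k2 ^ (1 - t2 / 2) * k3 ^ (1 - t3 / 2)) ≤
      (k1 * k2 * k3 + k0 * k2 * k3 + k0 * k1 * k3 + k0 * k1 * k2) ^ ((1 : ℝ) / 2) *
        (k0 * k1 * k2 * k3) ^ ((1 : ℝ) / 2) := by
  have key := Real.geom_mean_le_arith_mean4_weighted ht0 ht1 ht2 ht3
    (by positivity : 0 ≤ k1 * k2 * k3) (by positivity : 0 ≤ k0 * k2 * k3)
    (by positivity : 0 ≤ k0 * k1 * k3) (by positivity : 0 ≤ k0 * k1 * k2) ht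
  have q0 : 0 ≤ k1 * k2 * k3 := by positivity
  have q1 : 0 ≤ k0 * k2 * k3 := by positivity
  have q2 : 0 ≤ k0 * k1 * k3 := by positivity
  have q3 : 0 ≤ k0 * k1 * k2 := by positivity
  have key2 : (k1 * k2 * k3) ^ t0 * (k0 * k2 * k3) ^ t1 * (k0 * k1 * k3) ^ t2 *
      (k0 * k1 * k2) ^ t3 ≤ k1 * k2 * k3 + k0 * k2 * k3 + k0 * k1 * k3 + k0 * k1 * k2 := by
    refine key.trans ?_
    have e : ∀ t q : ℝ, t ≤ 1 → 0 ≤ q → t * q ≤ q := fun t q a b => by nlinarith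
    have e0 := e t0 _ (by linarith) q0
    have e1 := e t1 _ (by linarith) q1
    have e2 := e t2 _ (by linarith) q2
    have e3 := e t3 _ (by linarith) q3
    linarith
  have e : ∀ k u v w t : ℝ, 0 ≤ k → 0 ≤ u → 0 ≤ v → 0 ≤ w → t + u + v + w = 1 →
      k ^ (1 - t / 2) = (k ^ u * k ^ v * k ^ w) ^ ((1 : ℝ) / 2) * k ^ ((1 : ℝ) / 2) := by
    intro k u v w t hk hu hv hw hs
    rw [← Real.rpow_add_of_nonneg hk hu hv, ← Real.rpow_add_of_nonneg hk (by linarith) hw,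
      ← Real.rpow_mul hk, ← Real.rpow_add_of_nonneg hk (by positivity) (by norm_num)]
    congr 1; linarith
  refine le_trans (le_of_eq ?_) (mul_le_mul_of_nonneg_right
    (Real.rpow_le_rpow (by positivity) key2 (by norm_num : (0:ℝ) ≤ 1 / 2)) (by positivity))
  rw [e k0 t1 t2 t3 t0 h0 ht1 ht2 ht3 (by linarith), e k1 t0 t2 t3 t1 h1 ht0 ht2 ht3 (by linarith),
    e k2 t0 t1 t3 t2 h2 ht0 ht1 ht3 (by linarith), e k3 t0 t1 t2 t3 h3 ht0 ht1 ht2 (by linarith)]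
  simp (disch := positivity) only [Real.mul_rpow]
  ring

lemma step {E : Type*} [MeasurableSpace E] {μ : Measure E} {f g : E → ℝ≥0∞} {c M : ℝ≥0∞} (hg : Measurable g) (hM : ∫⁻ x, g x ∂μ ≤ M)
    (h : ∀ x, f x ≤ g x * c) : ∫⁻ x, f x ∂μ ≤ M * c := by
  refine (lintegral_mono h).trans ?_
  rw [lintegral_mul_const _ hg]
  gcongr

section
variable {E : Type*} [MeasurableSpace E] {μ : Measure E} [SFinite μ]

lemma cs1 {f g : E → ℝ≥0∞} (hf : Measurable f) (hg : Measurable g) :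
    ∫⁻ x, f x ^ ((1 : ℝ) / 2) * g x ^ ((1 : ℝ) / 2) ∂μ ≤
      (∫⁻ x, f x ∂μ) ^ ((1 : ℝ) / 2) * (∫⁻ x, g x ∂μ) ^ ((1 : ℝ) / 2) := by
  have := ENNReal.lintegral_mul_le_Lp_mul_Lq μ (p := 2) (q := 2)
    (by constructor <;> norm_num)
    (f := fun x => f x ^ ((1 : ℝ) / 2)) (g := fun x => g x ^ ((1 : ℝ) / 2))
    (by fun_prop) (by fun_prop)
  have e : ∀ a : ℝ≥0∞, (a ^ ((1 : ℝ) / 2)) ^ (2 : ℝ) = a := fun a => by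
    rw [← ENNReal.rpow_mul]; norm_num
  simpa only [e, Pi.mul_apply] using this

lemma cs3 (f g : E → E → E → ℝ≥0∞) (hf : Measurable fun p : E × E × E => f p.1 p.2.1 p.2.2)
    (hg : Measurable fun p : E × E × E => g p.1 p.2.1 p.2.2) :
    ∫⁻ z, ∫⁻ y, ∫⁻ x, f x y z ^ ((1 : ℝ) / 2) * g x y z ^ ((1 : ℝ) / 2) ∂μ ∂μ ∂μ ≤
      (∫⁻ z, ∫⁻ y, ∫⁻ x, f x y z ∂μ ∂μ ∂μ) ^ ((1 : ℝ) / 2) *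
      (∫⁻ z, ∫⁻ y, ∫⁻ x, g x y z ∂μ ∂μ ∂μ) ^ ((1 : ℝ) / 2) := by
  refine le_trans ?_ (cs1 (by fun_prop) (by fun_prop))
  refine lintegral_mono fun z => ?_
  refine le_trans ?_ (cs1 (by fun_prop) (by fun_prop))
  refine lintegral_mono fun y => ?_
  exact cs1 (by fun_prop) (by fun_prop)

lemma rev3 (f : E → E → E → ℝ≥0∞) (hf : Measurable fun p : E × E × E => f p.1 p.2.1 p.2.2) :
    ∫⁻ z, ∫⁻ y, ∫⁻ x, f x y z ∂μ ∂μ ∂μ = ∫⁻ x, ∫⁻ y, ∫⁻ z, f x y z ∂μ ∂μ ∂μ := by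
  rw [lintegral_lintegral_swap]
  · rw [lintegral_congr fun y => lintegral_lintegral_swap (f := fun z x => f x y z) (by fun_prop)]
    rw [lintegral_lintegral_swap]
    fun_prop
  · fun_prop

lemma mv4 (f : E → E → E → E → ℝ≥0∞)
    (hf : Measurable fun p : E × E × E × E => f p.1 p.2.1 p.2.2.1 p.2.2.2) :
    ∫⁻ u, ∫⁻ x, ∫⁻ y, ∫⁻ z, f x y z u ∂μ ∂μ ∂μ ∂μ =
      ∫⁻ x, ∫⁻ y, ∫⁻ z, ∫⁻ u, f x y z u ∂μ ∂μ ∂μ ∂μ := by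
  rw [lintegral_lintegral_swap (by fun_prop)]
  refine lintegral_congr fun x => ?_
  rw [lintegral_lintegral_swap (by fun_prop)]
  refine lintegral_congr fun y => ?_
  rw [lintegral_lintegral_swap (by fun_prop)]


lemma s_bound (w : E → ℝ≥0∞) (K0 K1 K2 K3 : E → E → ℝ≥0∞) (M : ℝ≥0∞) (hw : Measurable w)
    (m0 : Measurable fun p : E × E => K0 p.1 p.2) (m1 : Measurable fun p : E × E => K1 p.1 p.2)
    (m2 : Measurable fun p : E × E => K2 p.1 p.2) (m3 : Measurable fun p : E × E => K3 p.1 p.2)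
    (r0 : ∀ y, ∫⁻ z, w z * K0 y z ∂μ ≤ M) (r1 : ∀ y, ∫⁻ z, w z * K1 y z ∂μ ≤ M)
    (r2 : ∀ y, ∫⁻ z, w z * K2 y z ∂μ ≤ M)
    (l1 : ∀ z, ∫⁻ y, w y * K1 y z ∂μ ≤ M)
    (l2 : ∀ z, ∫⁻ y, w y * K2 y z ∂μ ≤ M) (l3 : ∀ z, ∫⁻ y, w y * K3 y z ∂μ ≤ M) (x u : E) :
    ∫⁻ x₃, ∫⁻ x₂, ∫⁻ x₁, (w x₁ * w x₂ * w x₃) * (K1 x₁ x₂ * K2 x₂ x₃ * K3 x₃ u +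
      K0 x x₁ * K2 x₂ x₃ * K3 x₃ u + K0 x x₁ * K1 x₁ x₂ * K3 x₃ u +
      K0 x x₁ * K1 x₁ x₂ * K2 x₂ x₃) ∂μ ∂μ ∂μ ≤ 4 * M ^ 3 := by
  have p0 : ∫⁻ x₃, ∫⁻ x₂, ∫⁻ x₁, (w x₁ * w x₂ * w x₃) * (K1 x₁ x₂ * K2 x₂ x₃ * K3 x₃ u)
      ∂μ ∂μ ∂μ ≤ M * (M * M) := by
    refine step (g := fun x₃ => w x₃ * K3 x₃ u) (by fun_prop) (l3 u) fun x₃ => ?_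
    refine (step (g := fun x₂ => w x₂ * K2 x₂ x₃) (c := M * (w x₃ * K3 x₃ u))
      (by fun_prop) (l2 x₃) fun x₂ => ?_).trans (le_of_eq (by ring))
    refine (step (g := fun x₁ => w x₁ * K1 x₁ x₂)
      (c := (w x₂ * K2 x₂ x₃) * (w x₃ * K3 x₃ u))
      (by fun_prop) (l1 x₂) fun x₁ => le_of_eq (by ring)).trans (le_of_eq (by ring))
  have p1 : ∫⁻ x₃, ∫⁻ x₂, ∫⁻ x₁, (w x₁ * w x₂ * w x₃) * (K0 x x₁ * K2 x₂ x₃ * K3 x₃ u)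
      ∂μ ∂μ ∂μ ≤ M * (M * M) := by
    refine step (g := fun x₃ => w x₃ * K3 x₃ u) (by fun_prop) (l3 u) fun x₃ => ?_
    refine (step (g := fun x₂ => w x₂ * K2 x₂ x₃) (c := M * (w x₃ * K3 x₃ u))
      (by fun_prop) (l2 x₃) fun x₂ => ?_).trans (le_of_eq (by ring))
    refine (step (g := fun x₁ => w x₁ * K0 x x₁)
      (c := (w x₂ * K2 x₂ x₃) * (w x₃ * K3 x₃ u))
      (by fun_prop) (r0 x) fun x₁ => le_of_eq (by ring)).trans (le_of_eq (by ring))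
  have p2 : ∫⁻ x₃, ∫⁻ x₂, ∫⁻ x₁, (w x₁ * w x₂ * w x₃) * (K0 x x₁ * K1 x₁ x₂ * K3 x₃ u)
      ∂μ ∂μ ∂μ ≤ M * (M * M) := by
    rw [rev3 (fun x₁ x₂ x₃ => (w x₁ * w x₂ * w x₃) * (K0 x x₁ * K1 x₁ x₂ * K3 x₃ u))
      (by fun_prop)]
    refine step (g := fun x₁ => w x₁ * K0 x x₁) (by fun_prop) (r0 x) fun x₁ => ?_
    refine (step (g := fun x₂ => w x₂ * K1 x₁ x₂) (c := M * (w x₁ * K0 x x₁))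
      (by fun_prop) (r1 x₁) fun x₂ => ?_).trans (le_of_eq (by ring))
    refine (step (g := fun x₃ => w x₃ * K3 x₃ u)
      (c := (w x₂ * K1 x₁ x₂) * (w x₁ * K0 x x₁))
      (by fun_prop) (l3 u) fun x₃ => le_of_eq (by ring)).trans (le_of_eq (by ring))
  have p3 : ∫⁻ x₃, ∫⁻ x₂, ∫⁻ x₁, (w x₁ * w x₂ * w x₃) * (K0 x x₁ * K1 x₁ x₂ * K2 x₂ x₃)
      ∂μ ∂μ ∂μ ≤ M * (M * M) := by
    rw [rev3 (fun x₁ x₂ x₃ => (w x₁ * w x₂ * w x₃) * (K0 x x₁ * K1 x₁ x₂ * K2 x₂ x₃))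
      (by fun_prop)]
    refine step (g := fun x₁ => w x₁ * K0 x x₁) (by fun_prop) (r0 x) fun x₁ => ?_
    refine (step (g := fun x₂ => w x₂ * K1 x₁ x₂) (c := M * (w x₁ * K0 x x₁))
      (by fun_prop) (r1 x₁) fun x₂ => ?_).trans (le_of_eq (by ring))
    refine (step (g := fun x₃ => w x₃ * K2 x₂ x₃)
      (c := (w x₂ * K1 x₁ x₂) * (w x₁ * K0 x x₁))
      (by fun_prop) (r2 x₂) fun x₃ => le_of_eq (by ring)).trans (le_of_eq (by ring))
  have add3 : ∀ f g : E → E → E → ℝ≥0∞, (Measurable fun p : E × E × E => f p.1 p.2.1 p.2.2) →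
      ∫⁻ x₃, ∫⁻ x₂, ∫⁻ x₁, (f x₁ x₂ x₃ + g x₁ x₂ x₃) ∂μ ∂μ ∂μ =
      (∫⁻ x₃, ∫⁻ x₂, ∫⁻ x₁, f x₁ x₂ x₃ ∂μ ∂μ ∂μ) +
        ∫⁻ x₃, ∫⁻ x₂, ∫⁻ x₁, g x₁ x₂ x₃ ∂μ ∂μ ∂μ := by
    intro f g hf
    rw [← lintegral_add_left (by fun_prop)]
    refine lintegral_congr fun x₃ => ?_
    rw [← lintegral_add_left (by fun_prop)]
    refine lintegral_congr fun x₂ => ?_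
    rw [← lintegral_add_left (by fun_prop)]
  simp only [mul_add]
  rw [add3 (fun x₁ x₂ x₃ => (w x₁ * w x₂ * w x₃) * (K1 x₁ x₂ * K2 x₂ x₃ * K3 x₃ u) +
      (w x₁ * w x₂ * w x₃) * (K0 x x₁ * K2 x₂ x₃ * K3 x₃ u) +
      (w x₁ * w x₂ * w x₃) * (K0 x x₁ * K1 x₁ x₂ * K3 x₃ u))
      (fun x₁ x₂ x₃ => (w x₁ * w x₂ * w x₃) * (K0 x x₁ * K1 x₁ x₂ * K2 x₂ x₃)) (by fun_prop),
    add3 (fun x₁ x₂ x₃ => (w x₁ * w x₂ * w x₃) * (K1 x₁ x₂ * K2 x₂ x₃ * K3 x₃ u) +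
      (w x₁ * w x₂ * w x₃) * (K0 x x₁ * K2 x₂ x₃ * K3 x₃ u))
      (fun x₁ x₂ x₃ => (w x₁ * w x₂ * w x₃) * (K0 x x₁ * K1 x₁ x₂ * K3 x₃ u)) (by fun_prop),
    add3 (fun x₁ x₂ x₃ => (w x₁ * w x₂ * w x₃) * (K1 x₁ x₂ * K2 x₂ x₃ * K3 x₃ u))
      (fun x₁ x₂ x₃ => (w x₁ * w x₂ * w x₃) * (K0 x x₁ * K2 x₂ x₃ * K3 x₃ u)) (by fun_prop)]
  refine (add_le_add (add_le_add (add_le_add p0 p1) p2) p3).trans (le_of_eq (by ring))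

lemma b_bound (w : E → ℝ≥0∞) (K0 K1 K2 K3 : E → E → ℝ≥0∞) (M : ℝ≥0∞) (hw : Measurable w)
    (m0 : Measurable fun p : E × E => K0 p.1 p.2) (m1 : Measurable fun p : E × E => K1 p.1 p.2)
    (m2 : Measurable fun p : E × E => K2 p.1 p.2) (m3 : Measurable fun p : E × E => K3 p.1 p.2)
    (r0 : ∀ y, ∫⁻ z, w z * K0 y z ∂μ ≤ M) (r1 : ∀ y, ∫⁻ z, w z * K1 y z ∂μ ≤ M)
    (r2 : ∀ y, ∫⁻ z, w z * K2 y z ∂μ ≤ M) (r3 : ∀ y, ∫⁻ z, w z * K3 y z ∂μ ≤ M) (x : E) :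
    ∫⁻ u, ∫⁻ x₃, ∫⁻ x₂, ∫⁻ x₁, (w x₁ * w x₂ * w x₃ * w u) *
      (K0 x x₁ * K1 x₁ x₂ * K2 x₂ x₃ * K3 x₃ u) ∂μ ∂μ ∂μ ∂μ ≤ M ^ 4 := by
  rw [lintegral_congr fun u => rev3 (fun x₁ x₂ x₃ => (w x₁ * w x₂ * w x₃ * w u) *
      (K0 x x₁ * K1 x₁ x₂ * K2 x₂ x₃ * K3 x₃ u)) (by fun_prop),
    mv4 (fun x₁ x₂ x₃ u => (w x₁ * w x₂ * w x₃ * w u) *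
      (K0 x x₁ * K1 x₁ x₂ * K2 x₂ x₃ * K3 x₃ u)) (by fun_prop)]
  refine (step (c := M ^ 3) (g := fun x₁ => w x₁ * K0 x x₁) (by fun_prop) (r0 x)
    fun x₁ => ?_).trans (le_of_eq (by ring))
  refine (step (g := fun x₂ => w x₂ * K1 x₁ x₂) (c := M ^ 2 * (w x₁ * K0 x x₁))
      (by fun_prop) (r1 x₁) fun x₂ => ?_).trans (le_of_eq (by ring))
  refine (step (g := fun x₃ => w x₃ * K2 x₂ x₃)
      (c := M * (w x₂ * K1 x₁ x₂) * (w x₁ * K0 x x₁))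
      (by fun_prop) (r2 x₂) fun x₃ => ?_).trans (le_of_eq (by ring))
  exact (step (g := fun u => w u * K3 x₃ u)
      (c := (w x₃ * K2 x₂ x₃) * (w x₂ * K1 x₁ x₂) * (w x₁ * K0 x x₁))
      (by fun_prop) (r3 x₃) fun u => le_of_eq (by ring)).trans (le_of_eq (by ring))

lemma main_bound (w : E → ℝ≥0∞) (K0 K1 K2 K3 : E → E → ℝ≥0∞) (M c : ℝ≥0∞) (hw : Measurable w)
    (m0 : Measurable fun p : E × E => K0 p.1 p.2) (m1 : Measurable fun p : E × E => K1 p.1 p.2)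
    (m2 : Measurable fun p : E × E => K2 p.1 p.2) (m3 : Measurable fun p : E × E => K3 p.1 p.2)
    (r0 : ∀ y, ∫⁻ z, w z * K0 y z ∂μ ≤ M) (r1 : ∀ y, ∫⁻ z, w z * K1 y z ∂μ ≤ M)
    (r2 : ∀ y, ∫⁻ z, w z * K2 y z ∂μ ≤ M) (r3 : ∀ y, ∫⁻ z, w z * K3 y z ∂μ ≤ M)
    (l1 : ∀ z, ∫⁻ y, w y * K1 y z ∂μ ≤ M) (hc : c ≠ ∞)
    (l2 : ∀ z, ∫⁻ y, w y * K2 y z ∂μ ≤ M) (l3 : ∀ z, ∫⁻ y, w y * K3 y z ∂μ ≤ M) (x : E)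
    (F : E → E → E → E → ℝ≥0∞)
    (hF : ∀ x₁ x₂ x₃ u, F x₁ x₂ x₃ u ≤ c * (((w x₁ * w x₂ * w x₃) *
      (K1 x₁ x₂ * K2 x₂ x₃ * K3 x₃ u +
      K0 x x₁ * K2 x₂ x₃ * K3 x₃ u + K0 x x₁ * K1 x₁ x₂ * K3 x₃ u +
      K0 x x₁ * K1 x₁ x₂ * K2 x₂ x₃)) ^ ((1 : ℝ) / 2) * ((w x₁ * w x₂ * w x₃ * w u) *
      (K0 x x₁ * K1 x₁ x₂ * K2 x₂ x₃ * K3 x₃ u)) ^ ((1 : ℝ) / 2))) :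
    ∫⁻ u, (∫⁻ x₃, ∫⁻ x₂, ∫⁻ x₁, F x₁ x₂ x₃ u ∂μ ∂μ ∂μ) ^ 2 ∂μ ≤
      c ^ 2 * (4 * M ^ 3 * M ^ 4) := by
  have e : ∀ a : ℝ≥0∞, (a ^ ((1 : ℝ) / 2)) ^ 2 = a := fun a => by
    rw [← ENNReal.rpow_natCast, ← ENNReal.rpow_mul]; norm_num
  have h : ∀ u, (∫⁻ x₃, ∫⁻ x₂, ∫⁻ x₁, F x₁ x₂ x₃ u ∂μ ∂μ ∂μ) ^ 2 ≤
      (∫⁻ x₃, ∫⁻ x₂, ∫⁻ x₁, (w x₁ * w x₂ * w x₃ * w u) *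
      (K0 x x₁ * K1 x₁ x₂ * K2 x₂ x₃ * K3 x₃ u) ∂μ ∂μ ∂μ) * (c ^ 2 * (4 * M ^ 3)) := by
    intro u
    refine (pow_le_pow_left' (b := c * ((4 * M ^ 3) ^ ((1 : ℝ) / 2) *
      (∫⁻ x₃, ∫⁻ x₂, ∫⁻ x₁, (w x₁ * w x₂ * w x₃ * w u) *
      (K0 x x₁ * K1 x₁ x₂ * K2 x₂ x₃ * K3 x₃ u) ∂μ ∂μ ∂μ) ^ ((1 : ℝ) / 2))) ?_ 2).trans
      (le_of_eq ?_)
    · refine (lintegral_mono fun x₃ => lintegral_mono fun x₂ => lintegral_mono fun x₁ =>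
        hF x₁ x₂ x₃ u).trans ?_
      simp only [lintegral_const_mul' _ _ hc]
      gcongr
      refine (cs3 (fun x₁ x₂ x₃ => (w x₁ * w x₂ * w x₃) *
        (K1 x₁ x₂ * K2 x₂ x₃ * K3 x₃ u +
        K0 x x₁ * K2 x₂ x₃ * K3 x₃ u + K0 x x₁ * K1 x₁ x₂ * K3 x₃ u +
        K0 x x₁ * K1 x₁ x₂ * K2 x₂ x₃)) (fun x₁ x₂ x₃ => (w x₁ * w x₂ * w x₃ * w u) *
        (K0 x x₁ * K1 x₁ x₂ * K2 x₂ x₃ * K3 x₃ u)) (by fun_prop) (by fun_prop)).trans ?_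
      gcongr
      exact s_bound w K0 K1 K2 K3 M hw m0 m1 m2 m3 r0 r1 r2 l1 l2 l3 x u
    · rw [mul_pow, mul_pow, e, e]; ring
  refine (step (by fun_prop) (b_bound w K0 K1 K2 K3 M hw m0 m1 m2 m3 r0 r1 r2 r3 x) h).trans
    (le_of_eq (by ring))
end

lemma neg_exp (a r J J' : ℝ) (ha : -(1/2) ≤ a) (hr : 0 ≤ r) (hJ : 1 ≤ J) (hJ' : 1 ≤ J')
    (h : r ≤ 2 * J * J') :
    r ^ (-a) ≤ 2 * (J ^ ((1 : ℝ) / 2) * J' ^ ((1 : ℝ) / 2)) * r ^ (-(max a 0)) := by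
  have j1 : 1 ≤ J ^ ((1 : ℝ) / 2) := Real.one_le_rpow hJ (by norm_num)
  have j2 : 1 ≤ J' ^ ((1 : ℝ) / 2) := Real.one_le_rpow hJ' (by norm_num)
  rcases le_total 0 a with h0 | h0
  · rw [max_eq_left h0]
    have : 0 ≤ r ^ (-a) := by positivity
    have : 1 ≤ 2 * (J ^ ((1 : ℝ) / 2) * J' ^ ((1 : ℝ) / 2)) := by nlinarith
    nlinarith
  · rw [max_eq_right h0]
    simp only [neg_zero, Real.rpow_zero, mul_one]
    have hJJ : 1 ≤ 2 * J * J' := by nlinarith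
    calc r ^ (-a) ≤ (2 * J * J') ^ (-a) := Real.rpow_le_rpow hr h (by linarith)
      _ ≤ (2 * J * J') ^ ((1 : ℝ) / 2) := Real.rpow_le_rpow_of_exponent_le hJJ (by linarith)
      _ = 2 ^ ((1 : ℝ) / 2) * (J ^ ((1 : ℝ) / 2) * J' ^ ((1 : ℝ) / 2)) := by
        rw [Real.mul_rpow (by positivity) (by positivity),
          Real.mul_rpow (by positivity) (by positivity)]; ring
      _ ≤ _ := by
        gcongr
        calc (2 : ℝ) ^ ((1 : ℝ) / 2) ≤ 2 ^ (1 : ℝ) :=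
              Real.rpow_le_rpow_of_exponent_le (by norm_num) (by norm_num)
          _ = 2 := by simp

lemma real_bound (b0 a1 a2 a3 c0 c1 c2 c3 t0 t1 t2 t3 δ J1 J2 J3 J4 r0 r1 r2 r3 : ℝ)
    (ha1 : -(1/2) ≤ a1) (ha2 : -(1/2) ≤ a2) (ha3 : -(1/2) ≤ a3)
    (hJ1 : 1 ≤ J1) (hJ2 : 1 ≤ J2) (hJ3 : 1 ≤ J3) (hJ4 : 1 ≤ J4)
    (hr0 : 0 ≤ r0) (hr1 : 0 ≤ r1) (hr2 : 0 ≤ r2) (hr3 : 0 ≤ r3)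
    (g1 : r1 ≤ 2 * J1 * J2) (g2 : r2 ≤ 2 * J2 * J3) (g3 : r3 ≤ 2 * J3 * J4)
    (ht0 : 0 ≤ t0) (ht1 : 0 ≤ t1) (ht2 : 0 ≤ t2) (ht3 : 0 ≤ t3)
    (ht : t0 + t1 + t2 + t3 = 1)
    (e0 : b0 = c0 * (1 - t0 / 2)) (e1 : max a1 0 = c1 * (1 - t1 / 2))
    (e2 : max a2 0 = c2 * (1 - t2 / 2)) (e3 : max a3 0 = c3 * (1 - t3 / 2)) :
    J1 ^ (-δ) * J2 ^ (-δ) * J3 ^ (-δ) * J4 ^ (-(δ / 2)) *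
      (r0 ^ (-b0) * r1 ^ (-a1) * r2 ^ (-a2) * r3 ^ (-a3)) ≤
    8 * (((J1 ^ (-(δ - 1)) * J2 ^ (-(δ - 1)) * J3 ^ (-(δ - 1))) *
      (r1 ^ (-c1) * r2 ^ (-c2) * r3 ^ (-c3) + r0 ^ (-c0) * r2 ^ (-c2) * r3 ^ (-c3) +
       r0 ^ (-c0) * r1 ^ (-c1) * r3 ^ (-c3) + r0 ^ (-c0) * r1 ^ (-c1) * r2 ^ (-c2))) ^ ((1 : ℝ) / 2) *
      ((J1 ^ (-(δ - 1)) * J2 ^ (-(δ - 1)) * J3 ^ (-(δ - 1)) * J4 ^ (-(δ - 1))) *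
      (r0 ^ (-c0) * r1 ^ (-c1) * r2 ^ (-c2) * r3 ^ (-c3))) ^ ((1 : ℝ) / 2)) := by
  have n1 := neg_exp a1 r1 J1 J2 ha1 hr1 hJ1 hJ2 g1
  have n2 := neg_exp a2 r2 J2 J3 ha2 hr2 hJ2 hJ3 g2
  have n3 := neg_exp a3 r3 J3 J4 ha3 hr3 hJ3 hJ4 g3
  have E : ∀ r c t : ℝ, 0 ≤ r → r ^ (-(c * (1 - t / 2))) = (r ^ (-c)) ^ (1 - t / 2) := by
    intro r c t hr
    rw [← Real.rpow_mul hr]; congr 1; ring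
  rw [e1, E _ _ _ hr1] at n1
  rw [e2, E _ _ _ hr2] at n2
  rw [e3, E _ _ _ hr3] at n3
  have pb := pointwise_bound (r0 ^ (-c0)) (r1 ^ (-c1)) (r2 ^ (-c2)) (r3 ^ (-c3)) t0 t1 t2 t3
    (by positivity) (by positivity) (by positivity) (by positivity) ht0 ht1 ht2 ht3 ht
  have p1 : 0 < J1 := by linarith
  have p2 : 0 < J2 := by linarith
  have p3 : 0 < J3 := by linarith
  have p4 : 0 < J4 := by linarith
  have d : ∀ J : ℝ, 0 < J → J ^ (-δ) * J ^ ((1 : ℝ) / 2) * J ^ ((1 : ℝ) / 2) = J ^ (-(δ - 1)) := by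
    intro J hJ
    rw [← Real.rpow_add hJ, ← Real.rpow_add hJ]; congr 1; ring
  have d4 : J4 ^ (-(δ / 2)) * J4 ^ ((1 : ℝ) / 2) = (J4 ^ (-(δ - 1))) ^ ((1 : ℝ) / 2) := by
    rw [← Real.rpow_mul p4.le, ← Real.rpow_add p4]; congr 1; ring
  have d1 : J1 ^ (-δ) * J1 ^ ((1 : ℝ) / 2) ≤ J1 ^ (-(δ - 1)) := by
    rw [← Real.rpow_add p1]
    exact Real.rpow_le_rpow_of_exponent_le hJ1 (by linarith)
  have sq : ∀ J : ℝ, 0 ≤ J → J ^ ((1 : ℝ) / 2) * J ^ ((1 : ℝ) / 2) = J := by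
    intro J hJ
    rw [← Real.mul_rpow hJ hJ, ← Real.sqrt_eq_rpow, Real.sqrt_mul_self hJ]
  rw [e0, E _ _ _ hr0]
  calc _ ≤ J1 ^ (-δ) * J2 ^ (-δ) * J3 ^ (-δ) * J4 ^ (-(δ / 2)) *
      ((r0 ^ (-c0)) ^ (1 - t0 / 2) *
        (2 * (J1 ^ ((1 : ℝ) / 2) * J2 ^ ((1 : ℝ) / 2)) * (r1 ^ (-c1)) ^ (1 - t1 / 2)) *
        (2 * (J2 ^ ((1 : ℝ) / 2) * J3 ^ ((1 : ℝ) / 2)) * (r2 ^ (-c2)) ^ (1 - t2 / 2)) *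
        (2 * (J3 ^ ((1 : ℝ) / 2) * J4 ^ ((1 : ℝ) / 2)) * (r3 ^ (-c3)) ^ (1 - t3 / 2))) := by
        gcongr
    _ = 8 * ((J1 ^ (-δ) * J1 ^ ((1 : ℝ) / 2)) *
        (J2 ^ (-δ) * J2 ^ ((1 : ℝ) / 2) * J2 ^ ((1 : ℝ) / 2)) *
        (J3 ^ (-δ) * J3 ^ ((1 : ℝ) / 2) * J3 ^ ((1 : ℝ) / 2)) *
        (J4 ^ (-(δ / 2)) * J4 ^ ((1 : ℝ) / 2)) *
        ((r0 ^ (-c0)) ^ (1 - t0 / 2) * (r1 ^ (-c1)) ^ (1 - t1 / 2) *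
          (r2 ^ (-c2)) ^ (1 - t2 / 2) * (r3 ^ (-c3)) ^ (1 - t3 / 2))) := by ring
    _ ≤ 8 * (J1 ^ (-(δ - 1)) * J2 ^ (-(δ - 1)) * J3 ^ (-(δ - 1)) *
          (J4 ^ (-(δ - 1))) ^ ((1 : ℝ) / 2) *
          ((r1 ^ (-c1) * r2 ^ (-c2) * r3 ^ (-c3) + r0 ^ (-c0) * r2 ^ (-c2) * r3 ^ (-c3) +
            r0 ^ (-c0) * r1 ^ (-c1) * r3 ^ (-c3) +
            r0 ^ (-c0) * r1 ^ (-c1) * r2 ^ (-c2)) ^ ((1 : ℝ) / 2) *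
          (r0 ^ (-c0) * r1 ^ (-c1) * r2 ^ (-c2) * r3 ^ (-c3)) ^ ((1 : ℝ) / 2))) := by
        rw [d J2 p2, d J3 p3, d4]
        gcongr
    _ = _ := by
        rw [Real.mul_rpow (x := J1 ^ (-(δ - 1)) * J2 ^ (-(δ - 1)) * J3 ^ (-(δ - 1)))
          (by positivity) (by positivity),
          Real.mul_rpow (x := J1 ^ (-(δ - 1)) * J2 ^ (-(δ - 1)) * J3 ^ (-(δ - 1)) * J4 ^ (-(δ - 1)))
          (by positivity) (by positivity), 
          Real.mul_rpow (x := J1 ^ (-(δ - 1)) * J2 ^ (-(δ - 1)) * J3 ^ (-(δ - 1)))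
          (by positivity) (by positivity)]
        conv_lhs => rw [← sq (J1 ^ (-(δ - 1)) * J2 ^ (-(δ - 1)) * J3 ^ (-(δ - 1))) (by positivity)]
        ring

lemma choose_c (b0 b1 b2 b3 : ℝ) (h0 : 0 ≤ b0) (h1 : 0 ≤ b1) (h2 : 0 ≤ b2) (h3 : 0 ≤ b3)
    (h0' : b0 < 4) (h1' : b1 < 4) (h2' : b2 < 4) (h3' : b3 < 4) (hs : b0 + b1 + b2 + b3 < 14) :
    ∃ c0 c1 c2 c3 t0 t1 t2 t3 : ℝ, (0 ≤ c0 ∧ c0 < 4) ∧ (0 ≤ c1 ∧ c1 < 4) ∧ (0 ≤ c2 ∧ c2 < 4) ∧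
      (0 ≤ c3 ∧ c3 < 4) ∧ 0 ≤ t0 ∧ 0 ≤ t1 ∧ 0 ≤ t2 ∧ 0 ≤ t3 ∧ t0 + t1 + t2 + t3 = 1 ∧
      b0 = c0 * (1 - t0 / 2) ∧ b1 = c1 * (1 - t1 / 2) ∧ b2 = c2 * (1 - t2 / 2) ∧
      b3 = c3 * (1 - t3 / 2) := by
  obtain ⟨D, hD⟩ : ∃ D, D = 8 - (b0 + b1 + b2 + b3) / 2 := ⟨_, rfl⟩
  have hD1 : 1 < D := by linarith
  have key : ∀ b : ℝ, 0 ≤ b → b < 4 → 0 ≤ (2 - b / 2) / D ∧ b / 4 < 1 - (2 - b / 2) / D / 2 := by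
    intro b hb hb'
    refine ⟨div_nonneg (by linarith) (by linarith), ?_⟩
    have : (2 - b / 2) / D < 2 - b / 2 := div_lt_self (by linarith) hD1
    linarith
  have key2 : ∀ b t : ℝ, 0 ≤ b → b / 4 < 1 - t / 2 →
      (0 ≤ b / (1 - t / 2) ∧ b / (1 - t / 2) < 4) ∧ b = b / (1 - t / 2) * (1 - t / 2) := by
    intro b t hb h
    have : 0 < 1 - t / 2 := by linarith
    refine ⟨⟨by positivity, ?_⟩, (div_mul_cancel₀ _ this.ne').symm⟩
    rw [div_lt_iff₀ this]; linarith
  obtain ⟨u0, v0⟩ := key b0 h0 h0'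
  obtain ⟨u1, v1⟩ := key b1 h1 h1'
  obtain ⟨u2, v2⟩ := key b2 h2 h2'
  obtain ⟨u3, v3⟩ := key b3 h3 h3'
  obtain ⟨x0, y0⟩ := key2 _ _ h0 v0
  obtain ⟨x1, y1⟩ := key2 _ _ h1 v1
  obtain ⟨x2, y2⟩ := key2 _ _ h2 v2
  obtain ⟨x3, y3⟩ := key2 _ _ h3 v3
  refine ⟨_, _, _, _, _, _, _, _, x0, x1, x2, x3, u0, u1, u2, u3, ?_, y0, y1, y2, y3⟩
  have : D ≠ 0 := by linarith
  field_simp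
  rw [hD]; ring

theorem stmt6 (a₀ a₁ a₂ a₃ δ : ℝ)
    (h₀ : 0 ≤ a₀) (h₀' : a₀ < 4)
    (h₁ : -(1/2) ≤ a₁) (h₁' : a₁ < 4)
    (h₂ : -(1/2) ≤ a₂) (h₂' : a₂ < 4)
    (h₃ : -(1/2) ≤ a₃) (h₃' : a₃ < 4)
    (hsum : a₀ + a₁ + a₂ + a₃ < 14) (hδ : 5 < δ) :
    ∃ C : ℝ, 0 < C ∧ ∀ x : EuclideanSpace ℝ (Fin 4),
      (∫⁻ x₄ : EuclideanSpace ℝ (Fin 4),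
          (∫⁻ x₃ : EuclideanSpace ℝ (Fin 4), ∫⁻ x₂ : EuclideanSpace ℝ (Fin 4),
              ∫⁻ x₁ : EuclideanSpace ℝ (Fin 4),
              ENNReal.ofReal
                (Real.sqrt (1 + ‖x₁‖ ^ 2) ^ (-δ) * Real.sqrt (1 + ‖x₂‖ ^ 2) ^ (-δ) *
                  Real.sqrt (1 + ‖x₃‖ ^ 2) ^ (-δ) * Real.sqrt (1 + ‖x₄‖ ^ 2) ^ (-(δ / 2)) *
                  (‖x - x₁‖ ^ (-a₀) * ‖x₁ - x₂‖ ^ (-a₁) * ‖x₂ - x₃‖ ^ (-a₂) *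
                    ‖x₃ - x₄‖ ^ (-a₃)))) ^ 2)
        ^ ((1 : ℝ) / 2) ≤ ENNReal.ofReal C := by
  obtain ⟨c0, c1, c2, c3, t0, t1, t2, t3, ⟨i0, j0⟩, ⟨i1, j1⟩, ⟨i2, j2⟩, ⟨i3, j3⟩,
    ht0, ht1, ht2, ht3, ht, e0, e1, e2, e3⟩ :=
    choose_c a₀ (max a₁ 0) (max a₂ 0) (max a₃ 0) h₀ (le_max_right _ _) (le_max_right _ _)
      (le_max_right _ _) h₀' (max_lt h₁' (by norm_num)) (max_lt h₂' (by norm_num))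
      (max_lt h₃' (by norm_num)) (by
        rcases max_cases a₁ 0 with ⟨q1, _⟩ | ⟨q1, _⟩ <;>
        rcases max_cases a₂ 0 with ⟨q2, _⟩ | ⟨q2, _⟩ <;>
        rcases max_cases a₃ 0 with ⟨q3, _⟩ | ⟨q3, _⟩ <;>
        rw [q1, q2, q3] <;> linarith)
  obtain ⟨M0, f0, b0⟩ := kern_bound c0 (δ - 1) i0 j0 (by linarith)
  obtain ⟨M1, f1, b1⟩ := kern_bound c1 (δ - 1) i1 j1 (by linarith)
  obtain ⟨M2, f2, b2⟩ := kern_bound c2 (δ - 1) i2 j2 (by linarith)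
  obtain ⟨M3, f3, b3⟩ := kern_bound c3 (δ - 1) i3 j3 (by linarith)
  obtain ⟨M, hM⟩ : ∃ M, M = M0 + M1 + M2 + M3 := ⟨_, rfl⟩
  have hMf : M ≠ ∞ := by rw [hM]; simp [f0, f1, f2, f3]
  have k0 : M0 ≤ M := by rw [hM, add_assoc, add_assoc]; exact le_self_add
  have k1 : M1 ≤ M := by
    rw [hM, add_assoc, add_assoc]; exact le_self_add.trans le_add_self
  have k2 : M2 ≤ M := by rw [hM]; exact le_add_self.trans le_self_add
  have k3 : M3 ≤ M := by rw [hM]; exact le_add_self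
  have hfin : (ENNReal.ofReal 8) ^ 2 * (4 * M ^ 3 * M ^ 4) ≠ ∞ := by
    refine ENNReal.mul_ne_top (by simp) (ENNReal.mul_ne_top (ENNReal.mul_ne_top (by simp) ?_) ?_)
    · exact ENNReal.pow_ne_top hMf
    · exact ENNReal.pow_ne_top hMf
  have hfin2 : ((ENNReal.ofReal 8) ^ 2 * (4 * M ^ 3 * M ^ 4)) ^ ((1 : ℝ) / 2) ≠ ∞ :=
    ENNReal.rpow_ne_top_of_nonneg (by norm_num) hfin
  have mk : ∀ c : ℝ, Measurable fun p : EuclideanSpace ℝ (Fin 4) × EuclideanSpace ℝ (Fin 4) =>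
      ENNReal.ofReal (‖p.1 - p.2‖ ^ (-c)) := by
    intro c
    have : Measurable fun p : EuclideanSpace ℝ (Fin 4) × EuclideanSpace ℝ (Fin 4) =>
      ‖p.1 - p.2‖ := by fun_prop
    exact (this.pow_const _).ennreal_ofReal
  have mw : Measurable fun z : EuclideanSpace ℝ (Fin 4) =>
      ENNReal.ofReal (Real.sqrt (1 + ‖z‖ ^ 2) ^ (-(δ - 1))) := by
    have : Measurable fun z : EuclideanSpace ℝ (Fin 4) => Real.sqrt (1 + ‖z‖ ^ 2) := by fun_prop
    exact (this.pow_const _).ennreal_ofReal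
  have hJ : ∀ z : EuclideanSpace ℝ (Fin 4), 1 ≤ Real.sqrt (1 + ‖z‖ ^ 2) := fun z =>
    Real.one_le_sqrt.2 (by nlinarith [sq_nonneg ‖z‖])
  have hn : ∀ z : EuclideanSpace ℝ (Fin 4), ‖z‖ ≤ Real.sqrt (1 + ‖z‖ ^ 2) := fun z =>
    Real.le_sqrt_of_sq_le (by linarith)
  have hg : ∀ y z : EuclideanSpace ℝ (Fin 4), ‖y - z‖ ≤
      2 * Real.sqrt (1 + ‖y‖ ^ 2) * Real.sqrt (1 + ‖z‖ ^ 2) := fun y z => by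
    have := norm_sub_le y z
    nlinarith [hJ y, hJ z, hn y, hn z]
  refine ⟨(((ENNReal.ofReal 8) ^ 2 * (4 * M ^ 3 * M ^ 4)) ^ ((1 : ℝ) / 2)).toReal + 1,
    by positivity, fun x => ?_⟩
  refine le_trans ?_ (ENNReal.ofReal_le_ofReal (le_add_of_nonneg_right zero_le_one))
  rw [ENNReal.ofReal_toReal hfin2]
  refine ENNReal.rpow_le_rpow ?_ (by norm_num)
  refine main_bound (fun z => ENNReal.ofReal (Real.sqrt (1 + ‖z‖ ^ 2) ^ (-(δ - 1))))
    (fun y z => ENNReal.ofReal (‖y - z‖ ^ (-c0))) (fun y z => ENNReal.ofReal (‖y - z‖ ^ (-c1)))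
    (fun y z => ENNReal.ofReal (‖y - z‖ ^ (-c2))) (fun y z => ENNReal.ofReal (‖y - z‖ ^ (-c3)))
    M (ENNReal.ofReal 8) mw (mk c0) (mk c1) (mk c2) (mk c3) (fun y => (b0 y).trans k0)
    (fun y => (b1 y).trans k1) (fun y => (b2 y).trans k2) (fun y => (b3 y).trans k3)
    (fun y => ?_) ENNReal.ofReal_ne_top (fun y => ?_) (fun y => ?_) x 
    (fun x₁ x₂ x₃ x₄ => ENNReal.ofReal
                (Real.sqrt (1 + ‖x₁‖ ^ 2) ^ (-δ) * Real.sqrt (1 + ‖x₂‖ ^ 2) ^ (-δ) *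
                  Real.sqrt (1 + ‖x₃‖ ^ 2) ^ (-δ) * Real.sqrt (1 + ‖x₄‖ ^ 2) ^ (-(δ / 2)) *
                  (‖x - x₁‖ ^ (-a₀) * ‖x₁ - x₂‖ ^ (-a₁) * ‖x₂ - x₃‖ ^ (-a₂) *
                    ‖x₃ - x₄‖ ^ (-a₃)))) ?_
  · refine le_trans (le_of_eq ?_) ((b1 y).trans k1)
    simp only [norm_sub_rev y]
  · refine le_trans (le_of_eq ?_) ((b2 y).trans k2)
    simp only [norm_sub_rev y]
  · refine le_trans (le_of_eq ?_) ((b3 y).trans k3)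
    simp only [norm_sub_rev y]
  · intro x₁ x₂ x₃ u
    refine (ENNReal.ofReal_le_ofReal (real_bound a₀ a₁ a₂ a₃ c0 c1 c2 c3 t0 t1 t2 t3 δ _ _ _ _
      _ _ _ _ h₁ h₂ h₃ (hJ x₁) (hJ x₂) (hJ x₃) (hJ u) (norm_nonneg _) (norm_nonneg _)
      (norm_nonneg _) (norm_nonneg _) (hg _ _) (hg _ _) (hg _ _) ht0 ht1 ht2 ht3 ht
      e0 e1 e2 e3)).trans (le_of_eq ?_)
    simp (disch := positivity) only [ENNReal.ofReal_mul, ENNReal.ofReal_add,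
      ← ENNReal.ofReal_rpow_of_nonneg]
end

section
/- Let m > 0, 0 < z₁ ≤ 1 and c > 0. Then there is a constant C (depending only on m, z₁, c) such that for every choice of sign ±, every r ≥ 0, every t ∈ ℝ, and every continuously differentiable function a : (0,∞) → ℂ satisfying: a(z) = 0 for z ≥ z₁; a(z) = 0 whenever z·r ≤ c; |a(z)| ≤ z·(1 + z·r)^{−1/2} and |a′(z)| ≤ (1 + z·r)^{−1/2} for all z > 0; one has | ∫₀^∞ e^{−it√(z²+m²)} e^{±izr} a(z) dz | ≤ C·⟨t⟩^{−1}. -/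
open MeasureTheory

lemma aux_pointwise_s7 (m M T r z p G K1 K2 K3 : ℝ) (hm : 0 < m) (hM : 1 ≤ M) (hT : 0 < T)
    (hr : 0 < r) (hz : 0 < z) (hp : 0 < p) (hpM : p ≤ M)
    (hG : T * (z / p) - r ≤ |G|)
    (hK1 : K1 = 2 * M + 4 * M ^ 2 * (1 + 1 / m)) (hK2 : K2 = 1 + 2 * M)
    (hK3 : K3 = (1 + 1 / m) * (2 * M) * (M ^ 3 / m ^ 2)) :
    (1 + 1 / m) * (T / (T + G ^ 2)) * (z / Real.sqrt (r * z))
      + |G| / (T + G ^ 2) * (1 / Real.sqrt (r * z)) ≤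
    (K1 / (z * Real.sqrt (r * z))
      + K2 * (Real.sqrt T / (2 * Real.sqrt (r * z) * (1 + T * z / r)))
      + K3 * (Real.sqrt T * T * (m ^ 2 / p ^ 3) / (T + G ^ 2))) / T := by
  have hrz : 0 < r * z := by positivity
  obtain ⟨y, hy⟩ : ∃ y, y = Real.sqrt (r * z) := ⟨_, rfl⟩
  obtain ⟨S, hS⟩ : ∃ S, S = Real.sqrt T := ⟨_, rfl⟩
  have hy0 : 0 < y := by rw [hy]; positivity
  have hS0 : 0 < S := by rw [hS]; positivity
  have hy2 : y ^ 2 = r * z := by rw [hy]; exact Real.sq_sqrt hrz.le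
  have hS2 : S ^ 2 = T := by rw [hS]; exact Real.sq_sqrt hT.le
  rw [← hy, ← hS]
  have hM0 : 0 < M := by linarith
  have hD : 0 < T + G ^ 2 := by positivity
  have hGs : |G| ^ 2 = G ^ 2 := sq_abs G
  have hm1 : 0 < 1 + 1 / m := by positivity
  have hK1' : 0 < K1 := by rw [hK1]; positivity
  have hK2' : 0 < K2 := by rw [hK2]; positivity
  have hK3' : 0 < K3 := by rw [hK3]; positivity
  have t1 : 0 ≤ K1 / (z * y) / T := by positivity
  have t2 : 0 ≤ K2 * (S / (2 * y * (1 + T * z / r))) / T := by positivity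
  have t3 : 0 ≤ K3 * (S * T * (m ^ 2 / p ^ 3) / (T + G ^ 2)) / T := by positivity
  rw [add_div, add_div]
  rcases le_total (2 * M * r) (T * z) with h | h
  · have h1 : T * z / (2 * M) ≤ |G| := by
      have e1 : T * z / M ≤ T * (z / p) := by
        rw [mul_div_assoc]; gcongr
      have e2 : r ≤ T * z / (2 * M) := by
        rw [le_div_iff₀ (by positivity)]; linarith
      have e3 : T * z / M = T * z / (2 * M) + T * z / (2 * M) := by field_simp; ring
      linarith
    have hu : 0 < T * z / (2 * M) := by positivity
    have hG0 : 0 < |G| := lt_of_lt_of_le hu h1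
    have h2 : |G| / (T + G ^ 2) ≤ 2 * M / (T * z) := by
      have : |G| / (T + G ^ 2) ≤ 1 / (T * z / (2 * M)) := by
        rw [div_le_div_iff₀ hD hu]
        nlinarith
      calc _ ≤ _ := this
        _ = _ := by field_simp
    have h3 : T / (T + G ^ 2) ≤ T / (T * z / (2 * M)) ^ 2 := by
      gcongr
      nlinarith
    have h4 : T / (T * z / (2 * M)) ^ 2 * z = 4 * M ^ 2 / (T * z) := by field_simp; ring
    have : (1 + 1 / m) * (T / (T + G ^ 2)) * (z / y) + |G| / (T + G ^ 2) * (1 / y)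
        ≤ K1 / (z * y) / T := by
      calc _ ≤ (1 + 1 / m) * (T / (T * z / (2 * M)) ^ 2) * (z / y)
            + 2 * M / (T * z) * (1 / y) := by gcongr
        _ = (1 + 1 / m) * (T / (T * z / (2 * M)) ^ 2 * z) / y
            + 2 * M / (T * z) * (1 / y) := by ring
        _ = K1 / (z * y) / T := by rw [h4, hK1]; field_simp; ring
    linarith
  · have h1 : |G| / (T + G ^ 2) * (1 / y) ≤ K2 * (S / (2 * y * (1 + T * z / r))) / T := by
      have e1 : |G| / (T + G ^ 2) ≤ 1 / (2 * S) := by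
        rw [div_le_div_iff₀ hD (by positivity)]
        nlinarith [sq_nonneg (|G| - S)]
      have e2 : 1 + T * z / r ≤ K2 := by
        rw [hK2]
        have : T * z / r ≤ 2 * M := by rw [div_le_iff₀ hr]; exact h
        linarith
      have e3 : 0 < 1 + T * z / r := by positivity
      calc _ ≤ 1 / (2 * S) * (1 / y) := by gcongr
        _ = (1 + T * z / r) * (S / (2 * y * (1 + T * z / r))) / T := by
          rw [← hS2] at e3 ⊢
          field_simp
        _ ≤ _ := by gcongr
    have h2 : (1 + 1 / m) * (T / (T + G ^ 2)) * (z / y) ≤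
        K3 * (S * T * (m ^ 2 / p ^ 3) / (T + G ^ 2)) / T := by
      have e1 : S * (z / y) ≤ 2 * M := by
        refine abs_le_of_sq_le_sq' ?_ (by positivity) |>.2
        have : (S * (z / y)) ^ 2 = T * z / r := by
          rw [mul_pow, div_pow, hy2, hS2]; field_simp
        rw [this]
        have : T * z / r ≤ 2 * M := by rw [div_le_iff₀ hr]; exact h
        nlinarith
      have e2 : 1 ≤ (M ^ 3 / m ^ 2) * (m ^ 2 / p ^ 3) := by
        have : (M ^ 3 / m ^ 2) * (m ^ 2 / p ^ 3) = M ^ 3 / p ^ 3 := by field_simp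
        rw [this, one_le_div (by positivity)]
        gcongr
      calc _ = (1 + 1 / m) * (S * (z / y)) * 1 * (S / (T + G ^ 2)) := by
            rw [← hS2]; ring
        _ ≤ (1 + 1 / m) * (2 * M) * ((M ^ 3 / m ^ 2) * (m ^ 2 / p ^ 3)) * (S / (T + G ^ 2)) := by
            gcongr
        _ = _ := by rw [hK3]; field_simp
    linarith

set_option maxHeartbeats 2000000 in
lemma aux_main (m c : ℝ) (hm : 0 < m) (hc : 0 < c) :
    ∃ K : ℝ, 0 < K ∧ ∀ (ε σ : ℝ), (ε = 1 ∨ ε = -1) → (σ = 1 ∨ σ = -1) → ∀ r, 0 < r → c / r ≤ 1 →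
      ∀ T : ℝ, 0 < T → ∀ a : ℝ → ℂ, ContDiffOn ℝ 1 a (Set.Ioi 0) → a 1 = 0 → a (c / r) = 0 →
        (∀ z : ℝ, 0 < z → ‖a z‖ ≤ z / Real.sqrt (1 + z * r)) →
        (∀ z : ℝ, 0 < z → ‖deriv a z‖ ≤ 1 / Real.sqrt (1 + z * r)) →
        ‖∫ z in (c / r)..1,
            Complex.exp (Complex.I *
              ((ε * (T * Real.sqrt (z ^ 2 + m ^ 2) - σ * (z * r)) : ℝ) : ℂ)) * a z‖ ≤ K / T := by
  obtain ⟨M, hM⟩ : ∃ M, M = Real.sqrt (1 + m ^ 2) := ⟨_, rfl⟩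
  have hM1 : 1 ≤ M := by rw [hM, Real.one_le_sqrt]; nlinarith
  obtain ⟨K1, hK1⟩ : ∃ K1, K1 = 2 * M + 4 * M ^ 2 * (1 + 1 / m) := ⟨_, rfl⟩
  obtain ⟨K2, hK2⟩ : ∃ K2, K2 = 1 + 2 * M := ⟨_, rfl⟩
  obtain ⟨K3, hK3⟩ : ∃ K3, K3 = (1 + 1 / m) * (2 * M) * (M ^ 3 / m ^ 2) := ⟨_, rfl⟩
  have hK1' : 0 < K1 := by rw [hK1]; positivity
  have hK2' : 0 < K2 := by rw [hK2]; positivity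
  have hK3' : 0 < K3 := by rw [hK3]; positivity
  refine ⟨K1 * (2 / Real.sqrt c) + K2 * Real.pi + K3 * Real.pi, by positivity, ?_⟩
  intro ε σ hε hσ r hr hcr T hT a ha ha1 hac hab had
  have hcr0 : 0 < c / r := by positivity
  set p : ℝ → ℝ := fun z => Real.sqrt (z ^ 2 + m ^ 2) with hpdef
  have hp0 : ∀ z, 0 < p z := fun z => by simp only [hpdef]; positivity
  have hp2 : ∀ z, p z ^ 2 = z ^ 2 + m ^ 2 := fun z => Real.sq_sqrt (by positivity)
  have hp' : ∀ z, HasDerivAt p (z / p z) z := by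
    intro z
    have h1 : HasDerivAt (fun z : ℝ => z ^ 2 + m ^ 2) (2 * z) z := by
      simpa using (hasDerivAt_pow 2 z).add_const (m ^ 2)
    have := h1.sqrt (by positivity)
    refine HasDerivAt.congr_deriv this ?_
    simp only [hpdef]
    field_simp
  have hl' : ∀ z, HasDerivAt (fun z => z / p z) (m ^ 2 / p z ^ 3) z := by
    intro z
    have := (hasDerivAt_id z).div (hp' z) (hp0 z).ne'
    refine HasDerivAt.congr_deriv this ?_
    have h := hp0 z
    have h2 := hp2 z
    simp only [id_eq]
    field_simp
    linarith
  set G : ℝ → ℝ := fun z => T * (z / p z) - σ * r with hGdef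
  have hG' : ∀ z, HasDerivAt G (T * (m ^ 2 / p z ^ 3)) z := fun z =>
    ((hl' z).const_mul T).sub_const _
  have hφ' : ∀ z, HasDerivAt (fun z => ε * (T * p z - σ * (z * r))) (ε * G z) z := by
    intro z
    have := (((hp' z).const_mul T).sub (((hasDerivAt_id z).mul_const r).const_mul σ)).const_mul ε
    refine HasDerivAt.congr_deriv this ?_
    simp [hGdef]
  set E : ℝ → ℂ := fun z => Complex.exp (Complex.I *
              ((ε * (T * p z - σ * (z * r)) : ℝ) : ℂ)) with hEdef
  have hE' : ∀ z, HasDerivAt E (E z * (Complex.I * ((ε * G z : ℝ) : ℂ))) z := fun z =>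
    ((hφ' z).ofReal_comp.const_mul Complex.I).cexp
  have hEn : ∀ z, ‖E z‖ = 1 := fun z => by
    simp only [hEdef]; rw [mul_comm]; exact Complex.norm_exp_ofReal_mul_I _
  set N : ℝ → ℝ := fun z => G z / (T + G z ^ 2) with hNdef
  have hD : ∀ z, 0 < T + G z ^ 2 := fun z => by positivity
  set N' : ℝ → ℝ := fun z => T * (m ^ 2 / p z ^ 3) * (T - G z ^ 2) / (T + G z ^ 2) ^ 2 with hN'def
  have hN' : ∀ z, HasDerivAt N (N' z) z := by
    intro z
    have := (hG' z).div (((hG' z).pow 2).const_add T) (hD z).ne'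
    refine HasDerivAt.congr_deriv this ?_
    simp only [hN'def]
    congr 1
    simp
    ring
  have had' : ∀ z, 0 < z → HasDerivAt a (deriv a z) z := fun z hz =>
    ((ha.differentiableOn (by norm_num)).differentiableAt (Ioi_mem_nhds hz)).hasDerivAt
  have hEa : ContinuousOn (fun z => E z * a z) (Set.Ioi 0) := by
    apply ContinuousOn.mul _ ha.continuousOn
    exact fun z _ => (hE' z).continuousAt.continuousWithinAt
  set J : ℝ → ℂ := fun x => ∫ z in (c / r)..x, E z * a z with hJdef
  have hJ' : ∀ x, 0 < x → HasDerivAt J (E x * a x) x := by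
    intro x hx
    apply intervalIntegral.integral_hasDerivAt_right
    · apply ContinuousOn.intervalIntegrable
      apply hEa.mono
      intro u hu
      have := hu.1
      exact lt_of_lt_of_le (lt_min hcr0 hx) this
    · exact hEa.stronglyMeasurableAtFilter isOpen_Ioi x hx
    · exact hEa.continuousAt (Ioi_mem_nhds hx)
  set Ψ : ℝ → ℂ := fun x => -Complex.I * ε * (E x * (N x : ℂ) * a x) with hΨdef
  have hΨ' : ∀ x, 0 < x → HasDerivAt Ψ (-Complex.I * ε *
      ((E x * (Complex.I * ((ε * G x : ℝ) : ℂ)) * (N x : ℂ) + E x * (N' x : ℂ)) * a x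
        + E x * (N x : ℂ) * deriv a x)) x := by
    intro x hx
    exact (((hE' x).mul (hN' x).ofReal_comp).mul (had' x hx)).const_mul _
  have hε2 : (ε : ℂ) * ε = 1 := by rcases hε with h | h <;> simp [h]
  have hεn : ‖(ε : ℂ)‖ = 1 := by rcases hε with h | h <;> simp [h]
  set H : ℝ → ℝ := fun z => K1 * (-2 / Real.sqrt (r * z)) + K2 * Real.arctan (Real.sqrt (T * z / r))
    + K3 * Real.arctan (G z / Real.sqrt T) with hHdef
  have hH' : ∀ z, 0 < z → HasDerivAt H (K1 / (z * Real.sqrt (r * z))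
      + K2 * (Real.sqrt T / (2 * Real.sqrt (r * z) * (1 + T * z / r)))
      + K3 * (Real.sqrt T * T * (m ^ 2 / p z ^ 3) / (T + G z ^ 2))) z := by
    intro z hz
    have hrz : 0 < r * z := by positivity
    have q1 : HasDerivAt (fun z => -2 / Real.sqrt (r * z)) (1 / (z * Real.sqrt (r * z))) z := by
      have h1 := (((hasDerivAt_id z).const_mul r).sqrt (by simpa using hrz.ne'))
      have := (hasDerivAt_const z (-2 : ℝ)).div h1 (by simp; positivity)
      refine HasDerivAt.congr_deriv this ?_
      simp only [id_eq]
      have hs : Real.sqrt (r * z) ^ 2 = r * z := Real.sq_sqrt hrz.le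
      have hs0 : 0 < Real.sqrt (r * z) := by positivity
      rw [hs]
      field_simp
      ring
    have q2 : HasDerivAt (fun z => Real.arctan (Real.sqrt (T * z / r)))
        (Real.sqrt T / (2 * Real.sqrt (r * z) * (1 + T * z / r))) z := by
      have hq : 0 < T * z / r := by positivity
      have h1 := ((((hasDerivAt_id z).const_mul T).div_const r).sqrt
        (by simpa using hq.ne')).arctan
      refine HasDerivAt.congr_deriv h1 ?_
      simp only [id_eq]
      rw [Real.sq_sqrt hq.le]
      have e : Real.sqrt (T * z / r) = Real.sqrt T * Real.sqrt (r * z) / r := by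
        rw [← Real.sqrt_mul hT.le]
        have : T * z / r = (T * (r * z)) / r ^ 2 := by field_simp
        rw [this, Real.sqrt_div (by positivity), Real.sqrt_sq hr.le]
      rw [e]
      have hs0 : 0 < Real.sqrt (r * z) := by positivity
      have hs1 : 0 < Real.sqrt T := by positivity
      have hs2 : Real.sqrt T ^ 2 = T := Real.sq_sqrt hT.le
      have hs3 : 0 < 1 + T * z / r := by positivity
      generalize 1 + T * z / r = w at *
      field_simp
      linarith
    have q3 : HasDerivAt (fun z => Real.arctan (G z / Real.sqrt T))
        (Real.sqrt T * T * (m ^ 2 / p z ^ 3) / (T + G z ^ 2)) z := by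
      have h1 := ((hG' z).div_const (Real.sqrt T)).arctan
      refine HasDerivAt.congr_deriv h1 ?_
      have hs1 : 0 < Real.sqrt T := by positivity
      have hs2 : Real.sqrt T ^ 2 = T := Real.sq_sqrt hT.le
      have := hD z
      have e : 1 + (G z / Real.sqrt T) ^ 2 = (T + G z ^ 2) / T := by
        rw [div_pow, hs2]; field_simp
      rw [e]
      have := hp0 z
      field_simp
      linarith
    have := ((q1.const_mul K1).add (q2.const_mul K2)).add (q3.const_mul K3)
    refine HasDerivAt.congr_deriv this ?_
    ring
  have key : ∀ x, x ∈ Set.Icc (c / r) 1 → ‖J x - Ψ x‖ ≤ (H x - H (c / r)) / T := by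
    have hd : ∀ x, 0 < x → HasDerivAt (fun x => J x - Ψ x) _ x := fun x hx =>
      (hJ' x hx).sub (hΨ' x hx)
    have hd2 : ∀ x, 0 < x → HasDerivAt (fun x => (H x - H (c / r)) / T) _ x := fun x hx =>
      ((hH' x hx).sub_const (H (c / r))).div_const T
    apply image_norm_le_of_norm_deriv_right_le_deriv_boundary'
      (fun x hx => (hd x (lt_of_lt_of_le hcr0 hx.1)).continuousAt.continuousWithinAt)
      (fun x hx => (hd x (lt_of_lt_of_le hcr0 hx.1)).hasDerivWithinAt)
      _
      (fun x hx => (hd2 x (lt_of_lt_of_le hcr0 hx.1)).continuousAt.continuousWithinAt)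
      (fun x hx => (hd2 x (lt_of_lt_of_le hcr0 hx.1)).hasDerivWithinAt)
    · intro z hz
      have hz0 : 0 < z := lt_of_lt_of_le hcr0 hz.1
      have hpM : p z ≤ M := by
        rw [hM]; apply Real.sqrt_le_sqrt
        have := hz.2
        nlinarith
      have hpm : m ≤ p z := by
        apply Real.le_sqrt_of_sq_le
        nlinarith [sq_nonneg z]
      have hGl : T * (z / p z) - r ≤ |G z| := by
        have h1 : 0 < T * (z / p z) := by have := hp0 z; positivity
        have h2 := le_abs_self (G z)
        rcases hσ with h | h
        · simp only [hGdef, h] at h2 ⊢; linarith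
        · simp only [hGdef, h] at h2 ⊢; linarith
      refine le_trans ?_ (aux_pointwise_s7 m M T r z (p z) (G z) K1 K2 K3 hm hM1 hT hr hz0 (hp0 z) hpM
        hGl hK1 hK2 hK3)
      have hDz := hD z
      have ident : E z * a z - (-Complex.I * ε *
      ((E z * (Complex.I * ((ε * G z : ℝ) : ℂ)) * (N z : ℂ) + E z * (N' z : ℂ)) * a z
        + E z * (N z : ℂ) * deriv a z)) =
        E z * (((T / (T + G z ^ 2) : ℝ) : ℂ) * a z + Complex.I * ε * (N' z : ℂ) * a z
          + Complex.I * ε * (N z : ℂ) * deriv a z) := by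
        have e1 : (T / (T + G z ^ 2) : ℝ) = 1 - G z * N z := by
          simp only [hNdef]; field_simp; ring
        rw [e1]
        push_cast
        linear_combination (E z * a z * (G z : ℂ) * (N z : ℂ)) *
          (ε * ε * Complex.I_mul_I - hε2)
      rw [ident, norm_mul, hEn, one_mul]
      have hrz : 0 < r * z := by positivity
      have ha1 : ‖a z‖ ≤ z / Real.sqrt (r * z) := by
        refine (hab z hz0).trans ?_
        gcongr
        nlinarith
      have ha2 : ‖deriv a z‖ ≤ 1 / Real.sqrt (r * z) := by
        refine (had z hz0).trans ?_
        gcongr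
        nlinarith
      have hN'b : |N' z| ≤ 1 / m * (T / (T + G z ^ 2)) := by
        simp only [hN'def]
        have hpz := hp0 z
        have b1 : m ^ 2 / p z ^ 3 ≤ 1 / m := by
          rw [div_le_div_iff₀ (by positivity) hm]
          have : m ^ 3 ≤ p z ^ 3 := by gcongr
          nlinarith
        have b2 : |T - G z ^ 2| ≤ T + G z ^ 2 := by
          rw [abs_le]; constructor <;> nlinarith [sq_nonneg (G z)]
        rw [abs_div, abs_mul, abs_of_pos (by positivity : 0 < T * (m ^ 2 / p z ^ 3)),
          abs_of_pos (by positivity : 0 < (T + G z ^ 2) ^ 2)]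
        calc _ ≤ T * (1 / m) * (T + G z ^ 2) / (T + G z ^ 2) ^ 2 := by gcongr
          _ = _ := by field_simp
      have hNb : |N z| = |G z| / (T + G z ^ 2) := by
        simp only [hNdef]; rw [abs_div, abs_of_pos hDz]
      refine (norm_add₃_le).trans ?_
      simp only [norm_mul, Complex.norm_I, hεn, Complex.norm_real, Real.norm_eq_abs, one_mul]
      rw [hNb, abs_of_pos (by positivity : 0 < T / (T + G z ^ 2))]
      calc _ ≤ T / (T + G z ^ 2) * (z / Real.sqrt (r * z))
            + 1 / m * (T / (T + G z ^ 2)) * (z / Real.sqrt (r * z))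
            + |G z| / (T + G z ^ 2) * (1 / Real.sqrt (r * z)) := by gcongr
        _ = _ := by ring
    · simp [hJdef, hΨdef, hac]
  have k1 := key 1 ⟨hcr, le_refl _⟩
  have hΨ1 : Ψ 1 = 0 := by simp [hΨdef, ha1]
  rw [hΨ1, sub_zero] at k1
  refine k1.trans ?_
  gcongr
  simp only [hHdef]
  have e : r * (c / r) = c := by field_simp
  rw [e]
  have u1 := Real.arctan_lt_pi_div_two (Real.sqrt (T * 1 / r))
  have u2 := Real.neg_pi_div_two_lt_arctan (Real.sqrt (T * (c / r) / r))
  have u3 := Real.arctan_lt_pi_div_two (G 1 / Real.sqrt T)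
  have u4 := Real.neg_pi_div_two_lt_arctan (G (c / r) / Real.sqrt T)
  have u5 : -2 / Real.sqrt (r * 1) ≤ 0 := by
    rw [neg_div]; have : 0 ≤ 2 / Real.sqrt (r * 1) := by positivity
    linarith
  have u6 : -2 / Real.sqrt c = - (2 / Real.sqrt c) := neg_div _ _
  rw [u6]
  nlinarith

theorem stmt7 (m z₁ c : ℝ) (hm : 0 < m) (hz₁ : 0 < z₁) (hz₁' : z₁ ≤ 1) (hc : 0 < c) :
    ∃ C : ℝ, 0 < C ∧ ∀ (s : ℝ), (s = 1 ∨ s = -1) → ∀ (r : ℝ), 0 ≤ r → ∀ (t : ℝ),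
      ∀ a : ℝ → ℂ, ContDiffOn ℝ 1 a (Set.Ioi 0) →
        (∀ z : ℝ, z₁ ≤ z → a z = 0) →
        (∀ z : ℝ, 0 < z → z * r ≤ c → a z = 0) →
        (∀ z : ℝ, 0 < z → ‖a z‖ ≤ z / Real.sqrt (1 + z * r)) →
        (∀ z : ℝ, 0 < z → ‖deriv a z‖ ≤ 1 / Real.sqrt (1 + z * r)) →
        ‖∫ z in Set.Ioi (0 : ℝ),
            Complex.exp (Complex.I *
              ((-(t * Real.sqrt (z ^ 2 + m ^ 2)) + s * (z * r) : ℝ) : ℂ)) * a z‖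
          ≤ C / Real.sqrt (1 + t ^ 2) := by
  obtain ⟨K, hK, hmain⟩ := aux_main m c hm hc
  refine ⟨2 * (1 + K), by positivity, ?_⟩
  intro s hs r hr t a ha haz hac hab had
  have hRHS : 0 ≤ 2 * (1 + K) / Real.sqrt (1 + t ^ 2) := by positivity
  by_cases hrc : r ≤ c
  · have : ∀ z ∈ Set.Ioi (0 : ℝ), Complex.exp (Complex.I *
              ((-(t * Real.sqrt (z ^ 2 + m ^ 2)) + s * (z * r) : ℝ) : ℂ)) * a z = 0 := by
      intro z hz
      have hz0 : 0 < z := hz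
      rcases le_total z 1 with h | h
      · rw [hac z hz0 (by nlinarith), mul_zero]
      · rw [haz z (hz₁'.trans h), mul_zero]
    rw [setIntegral_congr_fun measurableSet_Ioi this]
    simpa using hRHS
  push Not at hrc
  have hr0 : 0 < r := hc.trans hrc
  have hcr0 : 0 < c / r := by positivity
  have hcr : c / r ≤ 1 := by rw [div_le_one hr0]; exact hrc.le
  have hcut : ∫ z in Set.Ioi (0 : ℝ),
            Complex.exp (Complex.I *
              ((-(t * Real.sqrt (z ^ 2 + m ^ 2)) + s * (z * r) : ℝ) : ℂ)) * a z
      = ∫ z in (c / r)..1, Complex.exp (Complex.I *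
              ((-(t * Real.sqrt (z ^ 2 + m ^ 2)) + s * (z * r) : ℝ) : ℂ)) * a z := by
    rw [intervalIntegral.integral_of_le hcr]
    apply setIntegral_eq_of_subset_of_forall_sdiff_eq_zero measurableSet_Ioi
    · intro z hz; exact hcr0.trans hz.1
    · rintro z ⟨hz, hz'⟩
      have hz0 : 0 < z := hz
      rcases le_or_gt z (c / r) with h | h
      · rw [hac z hz0 ((le_div_iff₀ hr0).1 h), mul_zero]
      · have : 1 < z := by
          by_contra hh
          exact hz' ⟨h, not_lt.1 hh⟩
        rw [haz z (hz₁'.trans this.le), mul_zero]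
  rw [hcut]
  have hs0 : 0 < Real.sqrt (1 + t ^ 2) := by positivity
  rcases le_total |t| 1 with ht | ht
  · have h1 : ‖∫ z in (c / r)..1, Complex.exp (Complex.I *
              ((-(t * Real.sqrt (z ^ 2 + m ^ 2)) + s * (z * r) : ℝ) : ℂ)) * a z‖
        ≤ 1 * |1 - c / r| := by
      apply intervalIntegral.norm_integral_le_of_norm_le_const
      intro z hz
      rw [Set.uIoc_of_le hcr] at hz
      have hz0 : 0 < z := hcr0.trans hz.1
      rw [norm_mul, mul_comm Complex.I, Complex.norm_exp_ofReal_mul_I, one_mul]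
      refine (hab z hz0).trans ?_
      have : 1 ≤ Real.sqrt (1 + z * r) := by
        rw [Real.one_le_sqrt]; nlinarith
      rw [div_le_one (by linarith)]
      linarith [hz.2]
    have h2 : |1 - c / r| ≤ 1 := by rw [abs_le]; constructor <;> linarith
    have h3 : Real.sqrt (1 + t ^ 2) ≤ 2 := by
      rw [Real.sqrt_le_left (by norm_num)]
      nlinarith [sq_abs t, abs_nonneg t]
    have h4 : 1 ≤ 2 * (1 + K) / Real.sqrt (1 + t ^ 2) := by
      rw [le_div_iff₀ hs0]; linarith
    linarith
  · have hT : 0 < |t| := by linarith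
    have h3 : Real.sqrt (1 + t ^ 2) ≤ 2 * |t| := by
      rw [Real.sqrt_le_left (by positivity)]
      nlinarith [sq_abs t]
    obtain ⟨ε, hε, hεt⟩ : ∃ ε : ℝ, (ε = 1 ∨ ε = -1) ∧ -t = ε * |t| := by
      rcases abs_choice t with h | h
      · exact ⟨-1, Or.inr rfl, by rw [h]; ring⟩
      · exact ⟨1, Or.inl rfl, by rw [h]; ring⟩
    have hσ : (-(ε * s) = 1 ∨ -(ε * s) = -1) := by
      rcases hε with h | h <;> rcases hs with h' | h' <;> simp [h, h']
    have hε2 : ε * ε = 1 := by rcases hε with h | h <;> simp [h]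
    have := hmain ε (-(ε * s)) hε hσ r hr0 hcr |t| hT a ha (haz 1 hz₁')
      (hac _ hcr0 (by field_simp; exact le_refl _)) hab had
    have heq : ∀ z : ℝ, ε * (|t| * Real.sqrt (z ^ 2 + m ^ 2) - -(ε * s) * (z * r))
        = -(t * Real.sqrt (z ^ 2 + m ^ 2)) + s * (z * r) := by
      intro z
      linear_combination (-Real.sqrt (z ^ 2 + m ^ 2)) * hεt + s * (z * r) * hε2
    simp only [heq] at this
    refine this.trans ?_
    rw [div_le_div_iff₀ hT hs0]
    nlinarith
end

section
/- Let C₀ ≥ 1. Then there is a constant C₁ depending only on C₀ such that the following holds. Let t ∈ ℝ with t ≠ 0, let z₀ ∈ ℝ, let φ : ℝ → ℝ be twice continuously differentiable with φ′(z₀) = 0 and 1 ≤ φ″(z) ≤ C₀ for all z ∈ ℝ, and let a : ℝ → ℂ be continuously differentiable with compact support. Then | ∫_ℝ e^{−itφ(z)} a(z) dz | ≤ C₁·( ∫_{|z−z₀| ≤ |t|^{−1/2}} |a(z)| dz + |t|^{−1} ∫_{|z−z₀| ≥ |t|^{−1/2}} ( |a(z)|·|z−z₀|^{−2} + |a′(z)|·|z−z₀|^{−1}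 ) dz ). -/
open MeasureTheory

lemma aux_psi (φ : ℝ → ℝ) (z₀ : ℝ) (h : ContDiff ℝ 2 φ) (h0 : deriv φ z₀ = 0)
    (h1 : ∀ z, 1 ≤ deriv (deriv φ) z) (hd : Differentiable ℝ (deriv φ)) (z : ℝ) :
    |z - z₀| ≤ |deriv φ z| := by
  have hm : Monotone (fun z => deriv φ z - z) := by
    apply monotone_of_deriv_nonneg (by fun_prop)
    intro x
    have : HasDerivAt (fun z => deriv φ z - z) (deriv (deriv φ) x - 1) x :=
      (hd x).hasDerivAt.sub (hasDerivAt_id x)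
    rw [this.deriv]; linarith [h1 x]
  rcases le_total z₀ z with hz | hz
  · have := hm hz
    simp only [h0] at this
    exact abs_le_abs_of_nonneg (by linarith) (by linarith)
  · have := hm hz
    simp only [h0] at this
    rw [abs_of_nonpos (by linarith), abs_of_nonpos (by linarith)]; linarith

theorem stmt11 (C₀ : ℝ) (hC₀ : 1 ≤ C₀) :
    ∃ C₁ : ℝ, 0 < C₁ ∧ ∀ (t : ℝ), t ≠ 0 → ∀ (z₀ : ℝ) (φ : ℝ → ℝ),
      ContDiff ℝ 2 φ → deriv φ z₀ = 0 →
      (∀ z : ℝ, 1 ≤ deriv (deriv φ) z ∧ deriv (deriv φ) z ≤ C₀) →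
      ∀ a : ℝ → ℂ, ContDiff ℝ 1 a → HasCompactSupport a →
        ‖∫ z : ℝ, Complex.exp (-Complex.I * ((t * φ z : ℝ) : ℂ)) * a z‖
          ≤ C₁ * ((∫ z in {z : ℝ | |z - z₀| ≤ (Real.sqrt |t|)⁻¹}, ‖a z‖) +
              |t|⁻¹ * ∫ z in {z : ℝ | (Real.sqrt |t|)⁻¹ ≤ |z - z₀|},
                (‖a z‖ / |z - z₀| ^ 2 + ‖deriv a z‖ / |z - z₀|)) := by
  refine ⟨3 + C₀, by linarith, ?_⟩
  intro t ht z₀ φ hφ h0 hφ2 a ha hsupp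
  have htp : 0 < |t| := abs_pos.mpr ht
  set δ : ℝ := (Real.sqrt |t|)⁻¹ with hδ
  have hδp : 0 < δ := by positivity
  have hδ2 : δ ^ 2 = |t|⁻¹ := by rw [hδ, inv_pow, Real.sq_sqrt htp.le]
  have hφd : Differentiable ℝ φ := hφ.differentiable (by norm_num)
  have hψ : ContDiff ℝ 1 (deriv φ) := hφ.deriv'
  have hψd : Differentiable ℝ (deriv φ) := hψ.differentiable (by norm_num)
  have hψc : Continuous (deriv φ) := hψ.continuous
  have hψ'c : Continuous (deriv (deriv φ)) := hψ.continuous_deriv (by norm_num)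
  have hac : Continuous a := ha.continuous
  have had : Differentiable ℝ a := ha.differentiable (by norm_num)
  have ha'c : Continuous (deriv a) := ha.continuous_deriv (by norm_num)
  have hφc : Continuous φ := hφ.continuous
  have hlow := aux_psi φ z₀ hφ h0 (fun z => (hφ2 z).1) hψd
  set K : Set ℝ := {z : ℝ | δ ≤ |z - z₀|} with hK
  have hKc : IsClosed K := isClosed_le (by fun_prop) (by fun_prop)
  have hKm : MeasurableSet K := hKc.measurableSet
  have hs0 : ∀ z ∈ K, 0 < |z - z₀| := fun z hz => lt_of_lt_of_le hδp hz
  have hs1 : ∀ z ∈ K, z - z₀ ≠ 0 := fun z hz => abs_pos.mp (hs0 z hz)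
  have hψ0 : ∀ z ∈ K, deriv φ z ≠ 0 := fun z hz =>
    abs_pos.mp (lt_of_lt_of_le (hs0 z hz) (hlow z))
  set e : ℝ → ℂ := fun z => Complex.exp (-Complex.I * ((t * φ z : ℝ) : ℂ)) with he
  have hec : Continuous e := by simp only [he]; fun_prop
  have hen : ∀ z, ‖e z‖ = 1 := by
    intro z
    have : -Complex.I * ((t * φ z : ℝ) : ℂ) = ((-(t * φ z) : ℝ) : ℂ) * Complex.I := by
      push_cast; ring
    simp only [he]
    rw [this, Complex.norm_exp_ofReal_mul_I]
  have hed : ∀ z, HasDerivAt e (e z * (-Complex.I * ((t * deriv φ z : ℝ) : ℂ))) z := by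
    intro z
    exact ((((hφd z).hasDerivAt.const_mul t).ofReal_comp).const_mul (-Complex.I)).cexp
  let χ : ℝ → ℝ := fun z => 1 - δ ^ 2 / (z - z₀) ^ 2
  let q : ℝ → ℝ := fun z => χ z / deriv φ z
  let q' : ℝ → ℝ := fun z => (2 * δ ^ 2 / (z - z₀) ^ 3) / deriv φ z
    - χ z * deriv (deriv φ) z / (deriv φ z) ^ 2
  have hqd : ∀ z ∈ K, HasDerivAt q (q' z) z := by
    intro z hz
    have h1 : HasDerivAt (fun z : ℝ => (z - z₀) ^ 2) (2 * (z - z₀)) z := by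
      exact (((hasDerivAt_id z).sub_const z₀).pow 2).congr_deriv (by simp)
    have h2 : HasDerivAt χ (2 * δ ^ 2 / (z - z₀) ^ 3) z := by
      have := ((hasDerivAt_const z (δ ^ 2)).div h1 (pow_ne_zero 2 (hs1 z hz))).const_sub 1
      refine this.congr_deriv ?_
      have := hs1 z hz
      field_simp
      ring
    refine (h2.div (hψd z).hasDerivAt (hψ0 z hz)).congr_deriv ?_
    have := hψ0 z hz
    simp only [q']
    field_simp
  have hχ : ∀ z ∈ K, |χ z| ≤ 1 := by
    intro z hz
    have h1 : δ ^ 2 ≤ (z - z₀) ^ 2 := by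
      rw [← sq_abs (z - z₀)]; exact pow_le_pow_left₀ hδp.le hz 2
    have h2 : 0 < (z - z₀) ^ 2 := by have := hs1 z hz; positivity
    have h3 : δ ^ 2 / (z - z₀) ^ 2 ≤ 1 := (div_le_one h2).2 h1
    have h4 : 0 ≤ δ ^ 2 / (z - z₀) ^ 2 := by positivity
    simp only [χ]
    rw [abs_le]; constructor <;> linarith
  have hqb : ∀ z ∈ K, |q z| ≤ 1 / |z - z₀| := by
    intro z hz
    simp only [q]; rw [abs_div]
    exact div_le_div₀ zero_le_one (hχ z hz) (hs0 z hz) (hlow z)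
  have hq'b : ∀ z ∈ K, |q' z| ≤ (2 + C₀) / |z - z₀| ^ 2 := by
    intro z hz
    have hp := hs0 z hz
    have h1 : |(2 * δ ^ 2 / (z - z₀) ^ 3) / deriv φ z| ≤ 2 / |z - z₀| ^ 2 := by
      rw [abs_div, abs_div, abs_pow, abs_of_nonneg (by positivity : 0 ≤ 2 * δ ^ 2)]
      calc 2 * δ ^ 2 / |z - z₀| ^ 3 / |deriv φ z|
          ≤ 2 * |z - z₀| ^ 2 / |z - z₀| ^ 3 / |z - z₀| := by
            have : δ ≤ |z - z₀| := hz
            have := hlow z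
            gcongr
        _ = 2 / |z - z₀| ^ 2 := by field_simp
    have h2 : |χ z * deriv (deriv φ) z / (deriv φ z) ^ 2| ≤ C₀ / |z - z₀| ^ 2 := by
      rw [abs_div, abs_mul, abs_pow]
      have h3 : |deriv (deriv φ) z| ≤ C₀ := by
        rw [abs_of_nonneg (by linarith [(hφ2 z).1])]; exact (hφ2 z).2
      have h4 : |χ z| * |deriv (deriv φ) z| ≤ C₀ := by
        nlinarith [hχ z hz, abs_nonneg (χ z), abs_nonneg (deriv (deriv φ) z)]
      exact div_le_div₀ (by linarith) h4 (by positivity) (by have := hlow z; gcongr)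
    calc |q' z| ≤ _ := abs_sub _ _
      _ ≤ 2 / |z - z₀| ^ 2 + C₀ / |z - z₀| ^ 2 := add_le_add h1 h2
      _ = _ := by ring
  let G : ℝ → ℂ := fun z => e z * a z * (q z : ℂ)
  let G' : ℝ → ℂ := fun z =>
    (e z * (-Complex.I * ((t * deriv φ z : ℝ) : ℂ)) * a z + e z * deriv a z) * (q z : ℂ)
      + e z * a z * (q' z : ℂ)
  have hGd : ∀ z ∈ K, HasDerivAt G (G' z) z := by
    intro z hz
    exact ((hed z).mul (had z).hasDerivAt).mul (hqd z hz).ofReal_comp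
  have hχc : ContinuousOn χ K := by
    apply continuousOn_const.sub
    apply continuousOn_const.div (by fun_prop)
    intro z hz; exact pow_ne_zero 2 (hs1 z hz)
  have hqc : ContinuousOn q K := hχc.div hψc.continuousOn hψ0
  have hq'c : ContinuousOn q' K := by
    apply ContinuousOn.sub
    · apply ContinuousOn.div _ hψc.continuousOn hψ0
      apply continuousOn_const.div (by fun_prop)
      intro z hz; exact pow_ne_zero 3 (hs1 z hz)
    · apply (hχc.mul hψ'c.continuousOn).div (by fun_prop)
      intro z hz; exact pow_ne_zero 2 (hψ0 z hz)
  have hqc' : ContinuousOn (fun z => (q z : ℂ)) K := Complex.continuous_ofReal.comp_continuousOn hqc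
  have hq'c' : ContinuousOn (fun z => (q' z : ℂ)) K :=
    Complex.continuous_ofReal.comp_continuousOn hq'c
  have hG'c : ContinuousOn G' K := by
    apply ContinuousOn.add
    · apply ContinuousOn.mul _ hqc'
      apply Continuous.continuousOn; fun_prop
    · apply ContinuousOn.mul _ hq'c'
      apply Continuous.continuousOn; fun_prop
  have ha0 : ∀ z, z ∉ tsupport a → a z = 0 := fun z hz => image_eq_zero_of_notMem_tsupport hz
  have ha'0 : ∀ z, z ∉ tsupport a → deriv a z = 0 := fun z hz =>
    Function.notMem_support.1 (fun h => hz (support_deriv_subset h))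
  have hint : ∀ {E : Type} [NormedAddCommGroup E] (f : ℝ → E), ContinuousOn f K →
      (∀ z, z ∉ tsupport a → f z = 0) → IntegrableOn f K := by
    intro E _ f hf hf0
    have hcp : IsCompact (K ∩ tsupport a) := hsupp.isCompact.inter_left hKc
    have h1 : IntegrableOn f (K ∩ tsupport a) :=
      (hf.mono Set.inter_subset_left).integrableOn_compact hcp
    exact h1.of_forall_diff_eq_zero hKm (fun z hz => hf0 z (fun h => hz.2 ⟨hz.1, h⟩))
  have hG'i : IntegrableOn G' K := hint G' hG'c (fun z hz => by simp [G', ha0 z hz, ha'0 z hz])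
  have hKU : K = Set.Iic (z₀ - δ) ∪ Set.Ici (z₀ + δ) := by
    ext z
    simp only [hK, Set.mem_setOf_eq, Set.mem_union, Set.mem_Iic, Set.mem_Ici, le_abs]
    constructor
    · rintro (h | h)
      · right; linarith
      · left; linarith
    · rintro (h | h)
      · right; linarith
      · left; linarith
  have hGs : HasCompactSupport G := by
    have : HasCompactSupport (fun z => e z * a z) := hsupp.mul_left
    exact this.mul_right
  have hG0 := hGs.is_zero_at_infty
  have htop : Filter.Tendsto G Filter.atTop (nhds 0) :=
    hG0.mono_left atTop_le_cocompact
  have hbot : Filter.Tendsto G Filter.atBot (nhds 0) :=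
    hG0.mono_left atBot_le_cocompact
  have hsub1 : Set.Iic (z₀ - δ) ⊆ K := by rw [hKU]; exact Set.subset_union_left
  have hsub2 : Set.Ici (z₀ + δ) ⊆ K := by rw [hKU]; exact Set.subset_union_right
  have hGz : ∫ z in K, G' z = 0 := by
    have hdis : Disjoint (Set.Iic (z₀ - δ)) (Set.Ici (z₀ + δ)) := by
      rw [Set.disjoint_left]
      intro z h1 h2
      simp only [Set.mem_Iic, Set.mem_Ici] at h1 h2
      linarith
    have e1 : G (z₀ - δ) = 0 := by
      have : χ (z₀ - δ) = 0 := by simp [χ, hδp.ne']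
      simp [G, q, this]
    have e2 : G (z₀ + δ) = 0 := by
      have : χ (z₀ + δ) = 0 := by simp [χ, hδp.ne']
      simp [G, q, this]
    rw [hKU, setIntegral_union hdis measurableSet_Ici (hG'i.mono_set hsub1) (hG'i.mono_set hsub2),
      integral_Ici_eq_integral_Ioi,
      integral_Iic_of_hasDerivAt_of_tendsto' (fun z hz => hGd z (hsub1 hz))
        (hG'i.mono_set hsub1) hbot,
      integral_Ioi_of_hasDerivAt_of_tendsto' (fun z hz => hGd z (hsub2 hz))
        (hG'i.mono_set (Set.Ioi_subset_Ici_self.trans hsub2)) htop, e1, e2]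
    simp
  have hFi : Integrable (fun z => e z * a z) :=
    (hec.mul hac).integrable_of_hasCompactSupport hsupp.mul_left
  have hai : Integrable (fun z => ‖a z‖) := (hac.integrable_of_hasCompactSupport hsupp).norm
  let B : ℝ → ℝ := fun z => ‖a z‖ / |z - z₀| ^ 2 + ‖deriv a z‖ / |z - z₀|
  have hBi : IntegrableOn B K := by
    apply hint B
    · apply ContinuousOn.add
      · exact ContinuousOn.div (by fun_prop) (by fun_prop) (fun z hz => pow_ne_zero 2 (hs0 z hz).ne')
      · exact ContinuousOn.div (by fun_prop) (by fun_prop) (fun z hz => (hs0 z hz).ne')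
    · intro z hz; simp [B, ha0 z hz, ha'0 z hz]
  have htc : (t : ℂ) ≠ 0 := by exact_mod_cast ht
  have hKb : ‖∫ z in K, e z * a z‖ ≤ (3 + C₀) * (|t|⁻¹ * ∫ z in K, B z) := by
    have h1 : ∫ z in K, e z * a z = ∫ z in K, (e z * a z + (Complex.I * t)⁻¹ * G' z) := by
      rw [integral_add hFi.integrableOn (hG'i.const_mul _), integral_const_mul, hGz]
      simp
    rw [h1, ← mul_assoc, ← integral_const_mul]
    apply norm_integral_le_of_norm_le (hBi.const_mul _)
    rw [ae_restrict_iff' hKm]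
    refine Filter.Eventually.of_forall (fun z hz => ?_)
    have hqψ : ((t * deriv φ z : ℝ) : ℂ) * (q z : ℂ) = t * (χ z : ℂ) := by
      rw [← Complex.ofReal_mul, ← Complex.ofReal_mul]
      congr 1
      have := hψ0 z hz
      simp only [q]; field_simp
    have h2 : e z * a z + (Complex.I * t)⁻¹ * G' z = e z * (a z * ((1 - χ z : ℝ) : ℂ)
        + (Complex.I * t)⁻¹ * (deriv a z * (q z : ℂ) + a z * (q' z : ℂ))) := by
      have h3 : G' z = -Complex.I * e z * a z * (((t * deriv φ z : ℝ) : ℂ) * (q z : ℂ))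
        + e z * (deriv a z * (q z : ℂ) + a z * (q' z : ℂ)) := by simp only [G']; ring
      rw [h3, hqψ]
      have := Complex.I_ne_zero
      push_cast
      field_simp
      ring
    have hp := hs0 z hz
    have hχ1 : |1 - χ z| = |t|⁻¹ / |z - z₀| ^ 2 := by
      simp only [χ, sub_sub_cancel]
      rw [hδ2, abs_div, abs_pow, abs_of_nonneg (by positivity)]
    rw [h2, norm_mul, hen, one_mul]
    calc _ ≤ ‖a z‖ * |1 - χ z| + |t|⁻¹ * (‖deriv a z‖ * |q z| + ‖a z‖ * |q' z|) := by
          refine (norm_add_le _ _).trans ?_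
          rw [norm_mul, norm_mul, norm_inv, norm_mul, Complex.norm_I, one_mul]
          simp only [Complex.norm_real, Real.norm_eq_abs]
          gcongr
          refine (norm_add_le _ _).trans ?_
          simp [norm_mul]
      _ ≤ ‖a z‖ * (|t|⁻¹ / |z - z₀| ^ 2) + |t|⁻¹ * (‖deriv a z‖ * (1 / |z - z₀|)
            + ‖a z‖ * ((2 + C₀) / |z - z₀| ^ 2)) := by
          rw [hχ1]
          have := hqb z hz
          have := hq'b z hz
          gcongr
      _ = |t|⁻¹ * ((3 + C₀) * (‖a z‖ / |z - z₀| ^ 2) + 1 * (‖deriv a z‖ / |z - z₀|)) := by ring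
      _ ≤ |t|⁻¹ * ((3 + C₀) * (‖a z‖ / |z - z₀| ^ 2) + (3 + C₀) * (‖deriv a z‖ / |z - z₀|)) := by
          gcongr; linarith
      _ = _ := by simp only [B]; ring
  have hKcb : ‖∫ z in Kᶜ, e z * a z‖ ≤ ∫ z in {z : ℝ | |z - z₀| ≤ δ}, ‖a z‖ := by
    calc _ ≤ ∫ z in Kᶜ, ‖a z‖ := by
          apply norm_integral_le_of_norm_le hai.integrableOn
          refine Filter.Eventually.of_forall (fun z => ?_)
          rw [norm_mul, hen, one_mul]
      _ ≤ _ := by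
          apply setIntegral_mono_set hai.integrableOn
            (Filter.Eventually.of_forall (fun z => norm_nonneg _))
          apply HasSubset.Subset.eventuallyLE
          intro z hz
          simp only [hK, Set.mem_compl_iff, Set.mem_setOf_eq, not_le] at hz
          exact hz.le
  have hnn : 0 ≤ ∫ z in {z : ℝ | |z - z₀| ≤ δ}, ‖a z‖ :=
    integral_nonneg (fun z => norm_nonneg _)
  rw [← integral_add_compl hKm hFi]
  calc _ ≤ _ := norm_add_le _ _
    _ ≤ (3 + C₀) * (|t|⁻¹ * ∫ z in K, B z) + ∫ z in {z : ℝ | |z - z₀| ≤ δ}, ‖a z‖ :=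
        add_le_add hKb hKcb
    _ ≤ (3 + C₀) * (|t|⁻¹ * ∫ z in K, B z)
        + (3 + C₀) * ∫ z in {z : ℝ | |z - z₀| ≤ δ}, ‖a z‖ := by
        gcongr
        exact le_mul_of_one_le_left hnn (by linarith)
    _ = _ := by simp only [B]; ring
end
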